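/- arXiv:2006.13923 — 2 statements merged into one kernel-verified Lean document; each statement's English description precedes it below -/
import Mathlib

section
/- Let r ≥ 2 be an integer and α a real number with 0 < α ≤ (r-1)²/r². For every positive semi-definite Hermitian matrix A ∈ M_n(ℂ) with ‖A‖_op ≤ 1 and all diagonal entries at most α, there exist diagonal projections P_1, …, P_r ∈ M_n(ℂ) with P_1 + ⋯ + P_r = I such that for every i ∈ {1,…,r} one has ‖P_i A P_i‖_op ≤ (√(1/r − α/(r−1)) + √α)². -/
open scoped ComplexOrder
/-- The operator norm (ℓ² → ℓ²) of a complex matrix. -/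
noncomputable def opNorm {n : ℕ} (A : Matrix (Fin n) (Fin n) ℂ) : ℝ :=
  ‖Matrix.toEuclideanCLM (𝕜 := ℂ) A‖

/-- A diagonal projection: a diagonal matrix each of whose diagonal entries is 0 or 1. -/
def IsDiagonalProjection {n : ℕ} (P : Matrix (Fin n) (Fin n) ℂ) : Prop :=
  ∃ d : Fin n → ℂ, P = Matrix.diagonal d ∧ ∀ i, d i = 0 ∨ d i = 1

section Colourings

open Polynomial ComplexConjugate

/-- The open upper half-plane together with the origin. -/
def InUpper (z : ℂ) : Prop := z = 0 ∨ 0 < z.im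

lemma first_order_truncation_ne_zero (f : ℂ[X]) (hf : ∀ z, InUpper z → f.eval z ≠ 0)
    {c : ℝ} (hc : 0 < c) {z : ℂ} (hz : InUpper z) : f.coeff 0 + z * f.coeff 1 / c ≠ 0 := by
  have h0 : f.eval 0 ≠ 0 := hf 0 (Or.inl rfl)
  have hc0 : f.coeff 0 = f.eval 0 := coeff_zero_eq_eval_zero f
  have hc1 : f.coeff 1 = f.derivative.eval 0 := by
    rw [← coeff_zero_eq_eval_zero, coeff_derivative]; simp
  have key := (IsAlgClosed.splits f).eval_derivative_div_eval_of_ne_zero h0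
  have him : (f.derivative.eval 0 / f.eval 0).im ≤ 0 := by
    rw [key]
    have : ∀ s : Multiset ℂ, (∀ a ∈ s, a.im ≤ 0) →
        ((s.map fun a => 1 / (0 - a)).sum).im ≤ 0 := by
      intro s
      induction s using Multiset.induction_on with
      | empty => simp
      | cons a s ih =>
        intro h
        rw [Multiset.map_cons, Multiset.sum_cons, Complex.add_im]
        have h1 := ih fun b hb => h b (Multiset.mem_cons_of_mem hb)
        have h2 := h a (Multiset.mem_cons_self a s)
        have h3 : (1 / (0 - a)).im ≤ 0 := by
          simp only [zero_sub, one_div, Complex.inv_im, Complex.neg_im, neg_neg, Complex.normSq_neg]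
          exact div_nonpos_of_nonpos_of_nonneg h2 (Complex.normSq_nonneg a)
        linarith
    refine this _ fun a ha => ?_
    by_contra hlt
    exact hf a (Or.inr (not_le.mp hlt)) (isRoot_of_mem_roots ha)
  rw [hc0, hc1]
  rcases hz with rfl | hz
  · simpa using h0
  · intro h
    have hcC : (c : ℂ) ≠ 0 := by exact_mod_cast hc.ne'
    have hz0 : z ≠ 0 := by rintro rfl; simp at hz
    have h2 : f.derivative.eval 0 / f.eval 0 = -((c : ℂ) * z⁻¹) := by
      field_simp at h ⊢
      linear_combination h
    rw [h2, Complex.neg_im, Complex.im_ofReal_mul, Complex.inv_im] at him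
    have : 0 < z.im / Complex.normSq z := div_pos hz (Complex.normSq_pos.mpr hz0)
    have h3 : c * (-z.im / Complex.normSq z) = -(c * (z.im / Complex.normSq z)) := by ring
    rw [h3] at him
    linarith [mul_pos hc this]

lemma norm_eval_le_of_forall_im_pos_ne_zero (f : ℂ[X]) (hf : ∀ z : ℂ, 0 < z.im → f.eval z ≠ 0)
    {N : ℕ} (hN : f.natDegree ≤ N) {w : ℂ} (hw : 0 < w.im) (x : ℂ) :
    ‖f.eval x‖ ≤ (1 + ‖x - w‖ / w.im) ^ N * ‖f.eval w‖ := by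
  set B := 1 + ‖x - w‖ / w.im
  have hB : 1 ≤ B := le_add_of_nonneg_right (by positivity)
  have key : ∀ s : Multiset ℂ, (∀ a ∈ s, a.im ≤ 0) →
      ‖(s.map fun a => x - a).prod‖ ≤ B ^ s.card * ‖(s.map fun a => w - a).prod‖ := by
    intro s
    induction s using Multiset.induction_on with
    | empty => simp
    | cons a s ih =>
      intro h
      have h1 := ih fun b hb => h b (Multiset.mem_cons_of_mem hb)
      have h2 := h a (Multiset.mem_cons_self a s)
      have h3 : w.im ≤ ‖w - a‖ := by
        have := (le_abs_self _).trans (Complex.abs_im_le_norm (w - a))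
        rw [Complex.sub_im] at this
        linarith
      have h4 : ‖x - a‖ ≤ B * ‖w - a‖ := by
        have : ‖x - a‖ ≤ ‖x - w‖ + ‖w - a‖ := norm_sub_le_norm_sub_add_norm_sub x w a
        have h5 : ‖x - w‖ ≤ ‖x - w‖ / w.im * ‖w - a‖ := by
          rw [div_mul_eq_mul_div, le_div_iff₀ hw]
          gcongr
        calc ‖x - a‖ ≤ ‖x - w‖ + ‖w - a‖ := this
          _ ≤ B * ‖w - a‖ := by simp only [B]; linarith
      simp only [Multiset.map_cons, Multiset.prod_cons, norm_mul, Multiset.card_cons, pow_succ]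
      calc ‖x - a‖ * ‖(s.map fun a => x - a).prod‖
          ≤ (B * ‖w - a‖) * (B ^ s.card * ‖(s.map fun a => w - a).prod‖) := by gcongr
        _ = _ := by ring
  have hprod : ∀ y, f.eval y = f.leadingCoeff * (f.roots.map fun a => y - a).prod := fun y => by
    conv_lhs => rw [(IsAlgClosed.splits f).eq_prod_roots]
    simp [eval_multiset_prod, Multiset.map_map]
  have hroots : ∀ a ∈ f.roots, a.im ≤ 0 := fun a ha => by
    by_contra hlt
    exact hf a (not_le.mp hlt) (isRoot_of_mem_roots ha)
  rw [hprod x, hprod w, norm_mul, norm_mul]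
  calc ‖f.leadingCoeff‖ * ‖(f.roots.map fun a => x - a).prod‖
      ≤ ‖f.leadingCoeff‖ * (B ^ f.roots.card * ‖(f.roots.map fun a => w - a).prod‖) := by
        gcongr; exact key _ hroots
    _ ≤ ‖f.leadingCoeff‖ * (B ^ N * ‖(f.roots.map fun a => w - a).prod‖) := by
        gcongr
        exact (card_roots' f).trans hN
    _ = _ := by ring

/-- `K / G` maps the upper half-plane to its closure. -/
def NevanlinnaPair (K G : ℝ[X]) : Prop :=
  ∀ z : ℂ, 0 < z.im → 0 ≤ (aeval z K * conj (aeval z G)).im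

lemma exists_eval_expansion (K : ℝ[X]) (x : ℝ) :
    ∃ K₁ : ℝ[X], K₁.eval x = K.derivative.eval x ∧
      ∀ z : ℂ, aeval z K = ((K.eval x : ℝ) : ℂ) + (z - x) * aeval z K₁ := by
  obtain ⟨K₁, hK₁⟩ : (X - C x) ∣ K - C (K.eval x) := by
    rw [dvd_iff_isRoot]; simp
  have hK : K = C (K.eval x) + (X - C x) * K₁ := by rw [← hK₁]; ring
  refine ⟨K₁, ?_, fun z => ?_⟩
  · conv_rhs => rw [hK]
    simp
  · conv_lhs => rw [hK]
    simp

lemma NevanlinnaPair.wronskian_nonneg {K G : ℝ[X]} (h : NevanlinnaPair K G) (x : ℝ) :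
    0 ≤ K.derivative.eval x * G.eval x - K.eval x * G.derivative.eval x := by
  obtain ⟨K₁, hK₁, hK⟩ := exists_eval_expansion K x
  obtain ⟨G₁, hG₁, hG⟩ := exists_eval_expansion G x
  rw [← hK₁, ← hG₁]
  set φ : ℝ → ℝ := fun ε =>
    (aeval (x + ε * Complex.I : ℂ) K₁).re * G.eval x - K.eval x * (aeval (x + ε * Complex.I : ℂ) G₁).re
      + ε * (aeval (x + ε * Complex.I : ℂ) K₁ * conj (aeval (x + ε * Complex.I : ℂ) G₁)).im
  have hcont : Continuous φ := by
    have h1 : ∀ P : ℝ[X], Continuous fun ε : ℝ => aeval (x + ε * Complex.I : ℂ) P := fun P =>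
      P.continuous_aeval.comp (by fun_prop)
    have := h1 K₁
    have := h1 G₁
    simp only [φ]
    fun_prop
  have h0 : φ 0 = K₁.eval x * G.eval x - K.eval x * G₁.eval x := by
    have : ∀ P : ℝ[X], (aeval (x : ℂ) P).re = P.eval x := fun P => by
      rw [show (x : ℂ) = algebraMap ℝ ℂ x from rfl, aeval_algebraMap_apply]; simp
    simp [φ, this]
  rw [← h0]
  refine ge_of_tendsto (hcont.continuousWithinAt (s := Set.Ioi 0) (x := 0)) ?_
  filter_upwards [self_mem_nhdsWithin] with ε hε
  have hε : 0 < ε := hε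
  have := h (x + ε * Complex.I) (by simpa using hε)
  have heq : (aeval (x + ε * Complex.I : ℂ) K * conj (aeval (x + ε * Complex.I : ℂ) G)).im
      = ε * φ ε := by
    rw [hK, hG]
    simp only [φ]
    set a := aeval (x + ε * Complex.I : ℂ) K₁
    set b := aeval (x + ε * Complex.I : ℂ) G₁
    simp [Complex.mul_re, Complex.mul_im]
    ring
  rw [heq] at this
  exact nonneg_of_mul_nonneg_right this hε

lemma NevanlinnaPair.monotoneOn_div {K G : ℝ[X]} (h : NevanlinnaPair K G) {s : Set ℝ}
    (hs : Convex ℝ s) (hG : ∀ x ∈ s, G.eval x ≠ 0) :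
    MonotoneOn (fun x => K.eval x / G.eval x) s := by
  refine monotoneOn_of_deriv_nonneg hs ?_ ?_ ?_
  · exact K.continuous.continuousOn.div G.continuous.continuousOn hG
  · exact K.differentiable.differentiableOn.div G.differentiable.differentiableOn
      fun x hx => hG x (interior_subset hx)
  · intro x hx
    rw [deriv_fun_div K.differentiableAt G.differentiableAt (hG x (interior_subset hx))]
    rw [K.deriv, G.deriv]
    exact div_nonneg (h.wronskian_nonneg x) (sq_nonneg _)

lemma exists_im_pos_pow_eq_I {M : ℕ} (hM : 2 ≤ M) :
    (∃ ω : ℂ, 0 < ω.im ∧ ω ^ M = Complex.I) ∧ ∃ ω : ℂ, 0 < ω.im ∧ ω ^ M = -Complex.I := by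
  have hM0 : (0 : ℝ) < M := by positivity
  have hM2 : (2 : ℝ) ≤ M := by exact_mod_cast hM
  have hMC : (M : ℂ) ≠ 0 := by exact_mod_cast hM0.ne'
  refine ⟨⟨Complex.exp ((Real.pi / 2 / M : ℝ) * Complex.I), ?_, ?_⟩,
    ⟨Complex.exp ((3 * (Real.pi / 2) / M : ℝ) * Complex.I), ?_, ?_⟩⟩
  · rw [Complex.exp_ofReal_mul_I_im]
    refine Real.sin_pos_of_pos_of_lt_pi (by positivity) ?_
    rw [div_lt_iff₀ hM0]
    nlinarith [Real.pi_pos]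
  · rw [← Complex.exp_nat_mul]
    have : (M : ℂ) * ((Real.pi / 2 / M : ℝ) * Complex.I) = Real.pi / 2 * Complex.I := by
      push_cast; field_simp
    rw [this, Complex.exp_pi_div_two_mul_I]
  · rw [Complex.exp_ofReal_mul_I_im]
    refine Real.sin_pos_of_pos_of_lt_pi (by positivity) ?_
    rw [div_lt_iff₀ hM0]
    nlinarith [Real.pi_pos]
  · rw [← Complex.exp_nat_mul]
    have : (M : ℂ) * ((3 * (Real.pi / 2) / M : ℝ) * Complex.I)
        = Real.pi / 2 * Complex.I + Real.pi * Complex.I := by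
      push_cast; field_simp; ring
    rw [this, Complex.exp_add, Complex.exp_pi_div_two_mul_I, Complex.exp_pi_mul_I]
    simp

lemma aeval_ofReal_complex (P : ℝ[X]) (x : ℝ) : aeval (x : ℂ) P = ((P.eval x : ℝ) : ℂ) := by
  rw [show (x : ℂ) = algebraMap ℝ ℂ x from rfl, aeval_algebraMap_apply]; simp

lemma NevanlinnaPair.eval_eq_zero_of_sq_dvd {q g : ℝ[X]} (h : NevanlinnaPair q g) (hq : q ≠ 0)
    {a : ℝ} (ha : (X - C a) ^ 2 ∣ q) : g.eval a = 0 := by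
  obtain ⟨u, hu, hndvd⟩ := exists_eq_pow_rootMultiplicity_mul_and_not_dvd q hq a
  set M := q.rootMultiplicity a
  have hM : 2 ≤ M := (le_rootMultiplicity_iff hq).mpr ha
  have hua : u.eval a ≠ 0 := fun h0 => hndvd (dvd_iff_isRoot.mpr h0)
  have key : ∀ ω : ℂ, 0 < ω.im → 0 ≤ (ω ^ M * ((u.eval a * g.eval a : ℝ) : ℂ)).im := by
    intro ω hω
    set φ : ℝ → ℝ := fun ε =>
      (ω ^ M * (aeval (a + ε * ω : ℂ) u * conj (aeval (a + ε * ω : ℂ) g))).im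
    have hcont : Continuous φ := by
      have h1 : ∀ P : ℝ[X], Continuous fun ε : ℝ => aeval (a + ε * ω : ℂ) P := fun P =>
        P.continuous_aeval.comp (by fun_prop)
      have := h1 u
      have := h1 g
      simp only [φ]
      fun_prop
    have h0 : φ 0 = (ω ^ M * ((u.eval a * g.eval a : ℝ) : ℂ)).im := by
      simp [φ, aeval_ofReal_complex]
    rw [← h0]
    refine ge_of_tendsto (hcont.continuousWithinAt (s := Set.Ioi 0) (x := 0)) ?_
    filter_upwards [self_mem_nhdsWithin] with ε hε
    have hε : 0 < ε := hε
    have h1 := h (a + ε * ω) (by simpa using mul_pos hε hω)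
    have h2 : aeval (a + ε * ω : ℂ) q * conj (aeval (a + ε * ω : ℂ) g) =
        ((ε ^ M : ℝ) : ℂ) *
          (ω ^ M * (aeval (a + ε * ω : ℂ) u * conj (aeval (a + ε * ω : ℂ) g))) := by
      conv_lhs => rw [hu]
      simp only [map_mul, map_pow, map_sub, aeval_X, aeval_C]
      simp
      ring
    rw [h2, Complex.im_ofReal_mul] at h1
    exact nonneg_of_mul_nonneg_right h1 (by positivity)
  obtain ⟨⟨ω₁, h1, h1'⟩, ω₂, h2, h2'⟩ := exists_im_pos_pow_eq_I hM
  have k1 := key ω₁ h1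
  have k2 := key ω₂ h2
  rw [h1', mul_comm, Complex.im_ofReal_mul] at k1
  rw [h2', mul_comm, Complex.im_ofReal_mul] at k2
  simp only [Complex.neg_im, Complex.I_im] at k1 k2
  have : u.eval a * g.eval a = 0 := by linarith
  exact (mul_eq_zero.mp this).resolve_left hua

/-- The monic real polynomial with prescribed multiset of roots. -/
noncomputable def rootPoly (m : Multiset ℝ) : ℝ[X] := (m.map fun a => X - C a).prod

lemma rootPoly_monic (m : Multiset ℝ) : (rootPoly m).Monic := monic_multisetProd_X_sub_C m

lemma natDegree_rootPoly (m : Multiset ℝ) : (rootPoly m).natDegree = m.card :=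
  natDegree_multiset_prod_X_sub_C_eq_card m

lemma rootPoly_cons (a : ℝ) (m : Multiset ℝ) : rootPoly (a ::ₘ m) = (X - C a) * rootPoly m := by
  simp [rootPoly]

lemma rootPoly_eq_mul_erase {a : ℝ} {m : Multiset ℝ} (ha : a ∈ m) :
    rootPoly m = (X - C a) * rootPoly (m.erase a) := by
  rw [← rootPoly_cons, Multiset.cons_erase ha]

lemma NevanlinnaPair.of_mul_X_sub_C {q g : ℝ[X]} {a : ℝ}
    (h : NevanlinnaPair ((X - C a) * q) ((X - C a) * g)) : NevanlinnaPair q g := by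
  intro z hz
  have h1 := h z hz
  have hne : z - a ≠ 0 := fun h0 => by
    have := congrArg Complex.im h0
    simp at this
    exact hz.ne' this
  have h2 : aeval z ((X - C a) * q) * conj (aeval z ((X - C a) * g)) =
      ((Complex.normSq (z - a) : ℝ) : ℂ) * (aeval z q * conj (aeval z g)) := by
    rw [← Complex.mul_conj]
    simp
    ring
  rw [h2, Complex.im_ofReal_mul] at h1
  exact nonneg_of_mul_nonneg_right h1 (Complex.normSq_pos.mpr hne)

/-- The functions `g` forming a Nevanlinna pair `(rootPoly m, g)` lie in the cone generated by
`± rootPoly m` and the polynomials `rootPoly (m.erase a)`, in dual form. -/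
lemma NevanlinnaPair.functional_nonneg (m : Multiset ℝ) (g : ℝ[X]) (hdeg : g.natDegree ≤ m.card)
    (h : NevanlinnaPair (rootPoly m) g) (L : ℝ[X] →ₗ[ℝ] ℝ) (hL0 : L (rootPoly m) = 0)
    (hL : ∀ a ∈ m, 0 ≤ L (rootPoly (m.erase a))) : 0 ≤ L g := by
  obtain ⟨k, hk⟩ : ∃ k, m.card = k := ⟨_, rfl⟩
  induction k generalizing m g L with
  | zero =>
    rw [Multiset.card_eq_zero] at hk
    subst hk
    rw [Multiset.card_zero, Nat.le_zero] at hdeg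
    rw [eq_C_of_natDegree_eq_zero hdeg, show C (g.coeff 0) = g.coeff 0 • rootPoly 0 by
      simp [rootPoly, smul_eq_C_mul]]
    simp [hL0]
  | succ k ih =>
    by_cases hroot : ∃ a ∈ m, g.eval a = 0
    · obtain ⟨a, ha, hga⟩ := hroot
      obtain ⟨g₁, rfl⟩ := dvd_iff_isRoot.mpr hga
      have hcard : (m.erase a).card = k := by rw [Multiset.card_erase_of_mem ha, hk]; rfl
      rw [rootPoly_eq_mul_erase ha] at h hL0
      refine ih (m.erase a) g₁ ?_ h.of_mul_X_sub_C (L ∘ₗ LinearMap.mulLeft ℝ (X - C a)) ?_ ?_ hcard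
      · rcases eq_or_ne g₁ 0 with rfl | hg₁
        · simp
        · rw [(monic_X_sub_C a).natDegree_mul' hg₁, natDegree_X_sub_C] at hdeg
          omega
      · simpa using hL0
      · intro a' ha'
        have : (X - C a) * rootPoly ((m.erase a).erase a') = rootPoly (m.erase a') := by
          rw [← rootPoly_cons]
          congr 1
          rw [Multiset.erase_comm]
          rcases eq_or_ne a a' with rfl | hne
          · exact Multiset.cons_erase ha'
          · exact Multiset.cons_erase ((Multiset.mem_erase_of_ne hne).mpr ha)
        simp only [LinearMap.comp_apply, LinearMap.mulLeft_apply, this]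
        exact hL a' (Multiset.mem_of_mem_erase ha')
    · push Not at hroot
      have hnodup : m.Nodup := by
        rw [Multiset.nodup_iff_ne_cons_cons]
        intro a t hm
        have ha : a ∈ m := by simp [hm]
        refine hroot a ha (h.eval_eq_zero_of_sq_dvd (rootPoly_monic m).ne_zero ?_)
        rw [hm, rootPoly_cons, rootPoly_cons]
        exact ⟨rootPoly t, by ring⟩
      obtain ⟨s, rfl⟩ : ∃ s : Finset ℝ, s.val = m := ⟨⟨m, hnodup⟩, rfl⟩
      have hcard : s.val.card = s.card := rfl
      have hprod : ∀ t : Finset ℝ, rootPoly t.val = ∏ b ∈ t, (X - C b) := fun t => rfl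
      have herase : ∀ a, s.val.erase a = (s.erase a).val := fun a => (Finset.erase_val s a).symm
      set q := rootPoly s.val with hq
      have hqroot : ∀ a ∈ s, q.eval a = 0 := fun a ha => by
        rw [hq, rootPoly_eq_mul_erase (a := a) ha]; simp
      set d : ℝ → ℝ := fun a => ∏ b ∈ s.erase a, (a - b)
      have hd : ∀ a ∈ s, d a ≠ 0 := fun a _ =>
        Finset.prod_ne_zero_iff.mpr fun b hb => sub_ne_zero.mpr (Finset.ne_of_mem_erase hb).symm
      have hderiv : ∀ a ∈ s, q.derivative.eval a = d a := fun a ha => by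
        rw [hq, rootPoly_eq_mul_erase (a := a) ha, herase, hprod]
        simp [derivative_mul, eval_prod, d]
      have hdecomp : g = g.coeff s.card • q +
          ∑ a ∈ s, (g.eval a / d a) • rootPoly (s.val.erase a) := by
        rw [← sub_eq_iff_eq_add']
        refine eq_of_degrees_lt_of_eval_finset_eq s ?_ ?_ ?_
        · rw [degree_lt_iff_coeff_zero]
          intro k hk
          rcases hk.eq_or_lt with rfl | hlt
          · have : q.coeff s.card = 1 := by
              have := (rootPoly_monic s.val).coeff_natDegree
              rwa [natDegree_rootPoly] at this
            simp [this]
          · rw [coeff_sub, coeff_smul, coeff_eq_zero_of_natDegree_lt (p := g) (by omega),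
              coeff_eq_zero_of_natDegree_lt (p := q) (by rw [hq, natDegree_rootPoly]; omega)]
            simp
        · refine (degree_sum_le _ _).trans_lt ?_
          rw [Finset.sup_lt_iff (by exact WithBot.bot_lt_coe _)]
          intro a ha
          refine (degree_smul_le _ _).trans_lt ?_
          rw [(rootPoly_monic _).ne_zero |> degree_eq_natDegree, natDegree_rootPoly,
            Multiset.card_erase_of_mem (a := a) ha]
          have : 0 < s.card := Finset.card_pos.mpr ⟨a, ha⟩
          exact_mod_cast Nat.pred_lt this.ne'
        · intro a ha
          rw [eval_sub, eval_smul, hqroot a ha, eval_finsetSum, Finset.sum_eq_single a]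
          · rw [eval_smul, herase, hprod, eval_prod]
            simp only [eval_sub, eval_X, eval_C, smul_eq_mul, mul_zero, sub_zero]
            exact (div_mul_cancel₀ _ (hd a ha)).symm
          · intro b hb hba
            rw [eval_smul, rootPoly_eq_mul_erase (a := a)]
            · simp
            · exact (Multiset.mem_erase_of_ne hba.symm).mpr ha
          · exact fun h => absurd ha h
      rw [hdecomp, map_add, map_smul, hL0, smul_zero, zero_add, map_sum]
      refine Finset.sum_nonneg fun a ha => ?_
      rw [map_smul]
      refine mul_nonneg ?_ (hL a ha)
      have hW := h.wronskian_nonneg a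
      rw [hqroot a ha, hderiv a ha, zero_mul, sub_zero] at hW
      have := div_nonneg hW (mul_self_nonneg (d a))
      rwa [mul_div_mul_left _ _ (hd a ha)] at this

/-- The real polynomial with constant term `1` whose reciprocal roots are the elements of `m`. -/
noncomputable def reciprocalPoly (m : Multiset ℝ) : ℝ[X] := (m.map fun a => 1 - C a * X).prod

lemma reciprocalPoly_cons (a : ℝ) (m : Multiset ℝ) :
    reciprocalPoly (a ::ₘ m) = (1 - C a * X) * reciprocalPoly m := by
  simp [reciprocalPoly]

lemma aeval_rootPoly (m : Multiset ℝ) {z : ℂ} (hz : z ≠ 0) :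
    aeval z (rootPoly m) = z ^ m.card * aeval z⁻¹ (reciprocalPoly m) := by
  induction m using Multiset.induction_on with
  | empty => simp [rootPoly, reciprocalPoly]
  | cons a m ih =>
    rw [rootPoly_cons, reciprocalPoly_cons, map_mul, map_mul, ih, Multiset.card_cons]
    simp
    field_simp
    ring

lemma eval_rootPoly (m : Multiset ℝ) {z : ℝ} (hz : z ≠ 0) :
    (rootPoly m).eval z = z ^ m.card * (reciprocalPoly m).eval z⁻¹ := by
  have := aeval_rootPoly m (z := z) (by exact_mod_cast hz)
  rw [← Complex.ofReal_inv, aeval_ofReal_complex, aeval_ofReal_complex] at this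
  exact_mod_cast this

lemma reciprocalPoly_coeff (m : Multiset ℝ) :
    (reciprocalPoly m).coeff 0 = 1 ∧ (reciprocalPoly m).coeff 1 = -m.sum := by
  induction m using Multiset.induction_on with
  | empty => simp [reciprocalPoly, coeff_one]
  | cons a m ih =>
    rw [reciprocalPoly_cons, sub_mul, one_mul, mul_assoc, coeff_sub, coeff_sub, coeff_C_mul,
      coeff_C_mul, coeff_X_mul_zero, show (1 : ℕ) = 0 + 1 from rfl, coeff_X_mul, ih.1]
    refine ⟨by ring, ?_⟩
    rw [zero_add, ih.2, Multiset.sum_cons]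
    ring

lemma rootPoly_coeff (m : Multiset ℝ) : (rootPoly m).coeff m.card = 1 ∧
    ∀ k, k + 1 = m.card → (rootPoly m).coeff k = -m.sum := by
  refine ⟨?_, fun k hk => ?_⟩
  · rw [← natDegree_rootPoly]; exact rootPoly_monic m
  · have h1 : (rootPoly m).nextCoeff = -m.sum := multiset_prod_X_sub_C_nextCoeff m
    rwa [nextCoeff_of_natDegree_pos (by rw [natDegree_rootPoly]; omega), natDegree_rootPoly,
      ← hk, Nat.add_sub_cancel] at h1

lemma eval_rootPoly_pos {m : Multiset ℝ} {b : ℝ} (h : ∀ a ∈ m, a < b) :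
    0 < (rootPoly m).eval b := by
  induction m using Multiset.induction_on with
  | empty => simp [rootPoly]
  | cons a m ih =>
    rw [rootPoly_cons, eval_mul]
    have h1 := h a (Multiset.mem_cons_self a m)
    have h2 := ih fun c hc => h c (Multiset.mem_cons_of_mem hc)
    simp only [eval_sub, eval_X, eval_C]
    exact mul_pos (sub_pos.mpr h1) h2

lemma aeval_reflect (r : ℕ) {g : ℝ[X]} (hg : g.natDegree ≤ r) {z : ℂ} (hz : z ≠ 0) :
    aeval z (reflect r g) = z ^ r * aeval z⁻¹ g := by
  let _ : Invertible z⁻¹ := invertibleOfNonzero (inv_ne_zero hz)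
  have := eval₂_reflect_mul_pow (algebraMap ℝ ℂ) z⁻¹ r g hg
  rw [invOf_eq_inv, inv_inv] at this
  rw [aeval_def, aeval_def, ← this, mul_comm, mul_assoc, ← mul_pow, inv_mul_cancel₀ hz]
  simp

lemma eval_reflect_real (r : ℕ) {g : ℝ[X]} (hg : g.natDegree ≤ r) {z : ℝ} (hz : z ≠ 0) :
    (reflect r g).eval z = z ^ r * g.eval z⁻¹ := by
  have := aeval_reflect r hg (z := z) (by exact_mod_cast hz)
  rw [← Complex.ofReal_inv, aeval_ofReal_complex, aeval_ofReal_complex] at this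
  exact_mod_cast this

lemma natDegree_reflect_le' (r : ℕ) {g : ℝ[X]} (hg : g.natDegree ≤ r) :
    (reflect r g).natDegree ≤ r := by
  rw [natDegree_le_iff_coeff_eq_zero]
  intro N hN
  rw [coeff_reflect, revAt_eq_self_of_lt hN]
  exact coeff_eq_zero_of_natDegree_lt (by omega)

lemma aeval_conj_real (P : ℝ[X]) (z : ℂ) : aeval (conj z) P = conj (aeval z P) :=
  aeval_algHom_apply Complex.conjAe.toAlgHom z P

/-- The barrier inequality: the logarithmic derivative `g / f` at `1 / b` dominates the ratio of
the degree one truncations of `g` and `f` at `x`. -/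
lemma NevanlinnaPair.truncation_ratio_le {g : ℝ[X]} {m : Multiset ℝ} {c b x : ℝ}
    (h : NevanlinnaPair g (C c * reciprocalPoly m)) (hc : 0 < c) (hg : g.natDegree ≤ m.card)
    (hm0 : 0 < m.card) (hb : 0 < b) (hm : ∀ a ∈ m, a < b ∧ x * ((b - a) + m.sum) ≤ m.card) :
    (g.coeff 0 + x * g.coeff 1 / m.card) * (C c * reciprocalPoly m).eval b⁻¹ ≤
      g.eval b⁻¹ * (c * (1 - x * m.sum / m.card)) := by
  set r := m.card with hr
  obtain ⟨k, hk⟩ : ∃ k, k + 1 = r := ⟨r - 1, by omega⟩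
  have hr0 : (0 : ℝ) < r := by exact_mod_cast hm0
  have hNev : NevanlinnaPair (rootPoly m) (reflect r g) := by
    intro z hz
    have hz0 : z ≠ 0 := by rintro rfl; simp at hz
    rw [aeval_rootPoly m hz0, aeval_reflect r hg hz0]
    have hw : 0 < (conj z⁻¹).im := by
      rw [Complex.conj_im, Complex.inv_im]
      have : 0 < z.im / Complex.normSq z := div_pos hz (Complex.normSq_pos.mpr hz0)
      linarith [neg_div (Complex.normSq z) z.im]
    have h1 := h _ hw
    rw [aeval_conj_real, aeval_conj_real, map_mul, aeval_C] at h1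
    have h2 : conj (aeval z⁻¹ g) * conj (conj ((algebraMap ℝ ℂ) c * aeval z⁻¹ (reciprocalPoly m)))
        = (c : ℂ) * (aeval z⁻¹ (reciprocalPoly m) * conj (aeval z⁻¹ g)) := by
      rw [Complex.conj_conj]
      simp
      ring
    rw [h2, Complex.im_ofReal_mul] at h1
    have h3 : z ^ m.card * aeval z⁻¹ (reciprocalPoly m) * conj (z ^ r * aeval z⁻¹ g) =
        ((Complex.normSq (z ^ r) : ℝ) : ℂ) * (aeval z⁻¹ (reciprocalPoly m) * conj (aeval z⁻¹ g)) := by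
      rw [← Complex.mul_conj, map_mul]
      ring
    rw [h3, Complex.im_ofReal_mul]
    exact mul_nonneg (Complex.normSq_nonneg _) (nonneg_of_mul_nonneg_right h1 hc)
  set q := rootPoly m with hq
  have hqb : 0 < q.eval b := eval_rootPoly_pos fun a ha => (hm a ha).1
  let L : ℝ[X] →ₗ[ℝ] ℝ := (1 - x * m.sum / r) • leval b -
    (q.eval b) • (lcoeff ℝ r + (x / r) • lcoeff ℝ k)
  have hL : ∀ p, L p = (1 - x * m.sum / r) * p.eval b -
      q.eval b * (p.coeff r + x / r * p.coeff k) := fun p => by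
    simp [L, leval]
    ring
  have hqc := rootPoly_coeff m
  have key : 0 ≤ L (reflect r g) := by
    refine hNev.functional_nonneg m _ (natDegree_reflect_le' r hg) L ?_ ?_
    · rw [hL, ← hq, hqc.1, hqc.2 k hk]
      ring
    · intro a ha
      have hcard : (m.erase a).card = k := by
        rw [Multiset.card_erase_of_mem ha, ← hr, ← hk]; rfl
      have hab := (hm a ha).1
      have h1 : (rootPoly (m.erase a)).coeff k = 1 := hcard ▸ (rootPoly_coeff (m.erase a)).1
      have h2 : (rootPoly (m.erase a)).coeff r = 0 :=
        coeff_eq_zero_of_natDegree_lt (by rw [natDegree_rootPoly]; omega)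
      have h3 : q.eval b = (b - a) * (rootPoly (m.erase a)).eval b := by
        rw [hq, rootPoly_eq_mul_erase ha]; simp
      have h4 : 0 < (rootPoly (m.erase a)).eval b :=
        eval_rootPoly_pos fun c hc => (hm c (Multiset.mem_of_mem_erase hc)).1
      rw [hL, h1, h2, h3]
      have h5 : 0 ≤ (1 - x * m.sum / r) - (b - a) * (x / r) := by
        have := (hm a ha).2
        have h6 : (1 - x * m.sum / r) - (b - a) * (x / r) = (r - x * ((b - a) + m.sum)) / r := by
          field_simp
          ring
        rw [h6]
        exact div_nonneg (by linarith) hr0.le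
      nlinarith [mul_nonneg h5 h4.le]
  rw [hL, eval_reflect_real r hg hb.ne', hq, eval_rootPoly m hb.ne', coeff_reflect, coeff_reflect,
    revAt_le le_rfl, revAt_le (by omega), Nat.sub_self, show r - k = 1 by omega, ← hr] at key
  have hbr : 0 < b ^ r := by positivity
  rw [eval_mul, eval_C]
  have h7 : 0 ≤ b ^ r * ((1 - x * m.sum / r) * g.eval b⁻¹ -
      (reciprocalPoly m).eval b⁻¹ * (g.coeff 0 + x / r * g.coeff 1)) := by linarith
  have h8 := mul_nonneg hc.le (nonneg_of_mul_nonneg_right h7 hbr)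
  have h9 : x * g.coeff 1 / r = x / r * g.coeff 1 := by ring
  rw [h9]
  nlinarith

lemma exists_eq_reciprocalPoly (r : ℕ) (f : ℝ[X]) (hf : f.natDegree ≤ r) (h0 : f.eval 0 ≠ 0)
    (hup : ∀ z : ℂ, 0 < z.im → aeval z f ≠ 0) :
    ∃ m : Multiset ℝ, m.card = r ∧ f = C (f.eval 0) * reciprocalPoly m := by
  induction r generalizing f with
  | zero =>
    refine ⟨0, rfl, ?_⟩
    have := eq_C_of_natDegree_eq_zero (Nat.le_zero.mp hf)
    rw [this]; simp [reciprocalPoly]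
  | succ r ih =>
    by_cases hdeg : f.natDegree = 0
    · obtain ⟨m, hm, hfm⟩ := ih f (by omega) h0 hup
      exact ⟨0 ::ₘ m, by simp [hm], by rw [reciprocalPoly_cons]; simpa using hfm⟩
    · obtain ⟨z, hz⟩ : ∃ z : ℂ, aeval z f = 0 := by
        refine IsAlgClosed.exists_aeval_eq_zero ℂ f ?_
        intro h
        exact hdeg (natDegree_eq_zero_iff_degree_le_zero.mpr h.le)
      have hzim : z.im = 0 := by
        refine le_antisymm (not_lt.mp fun h => hup z h hz) (not_lt.mp fun h => ?_)
        refine hup (conj z) (by simpa using h) ?_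
        rw [aeval_conj_real, hz, map_zero]
      obtain ⟨x, rfl⟩ : ∃ x : ℝ, z = x := ⟨z.re, Complex.ext rfl (by simpa using hzim)⟩
      rw [aeval_ofReal_complex] at hz
      have hx : f.eval x = 0 := by exact_mod_cast hz
      have hx0 : x ≠ 0 := by rintro rfl; exact h0 hx
      obtain ⟨f₁, rfl⟩ := dvd_iff_isRoot.mpr hx
      have hf₁ : f₁ ≠ 0 := by rintro rfl; simp at h0
      rw [(monic_X_sub_C x).natDegree_mul' hf₁, natDegree_X_sub_C] at hf
      obtain ⟨m, hm, hfm⟩ := ih f₁ (by omega) (fun h => h0 (by simp [h]))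
        (fun z hz h => hup z hz (by simp [h]))
      refine ⟨x⁻¹ ::ₘ m, by simp [hm], ?_⟩
      rw [reciprocalPoly_cons]
      conv_lhs => rw [hfm]
      have : (C x : ℝ[X]) * C x⁻¹ = 1 := by rw [← C_mul, mul_inv_cancel₀ hx0, C_1]
      simp only [eval_mul, eval_sub, eval_X, eval_C, zero_sub, C_mul, C_neg]
      linear_combination (-(X * C (f₁.eval 0) * reciprocalPoly m)) * this

lemma eval_reciprocalPoly_eq_zero {m : Multiset ℝ} {a : ℝ} (ha : a ∈ m) (ha0 : a ≠ 0) :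
    (reciprocalPoly m).eval a⁻¹ = 0 := by
  obtain ⟨t, rfl⟩ := Multiset.exists_cons_of_mem ha
  rw [reciprocalPoly_cons]
  simp [ha0]

lemma derivative_reciprocalPoly_eval (m : Multiset ℝ) {y : ℝ} (h : ∀ a ∈ m, 1 - a * y ≠ 0) :
    -(reciprocalPoly m).derivative.eval y =
      (reciprocalPoly m).eval y * (m.map fun a => a / (1 - a * y)).sum := by
  induction m using Multiset.induction_on with
  | empty => simp [reciprocalPoly]
  | cons a m ih =>
    have h1 := ih fun c hc => h c (Multiset.mem_cons_of_mem hc)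
    have h2 := h a (Multiset.mem_cons_self a m)
    rw [reciprocalPoly_cons, derivative_mul, Multiset.map_cons, Multiset.sum_cons]
    simp only [derivative_sub, derivative_one, derivative_C_mul, derivative_X, mul_one, eval_add,
      eval_mul, eval_sub, eval_neg, eval_C, eval_one, eval_X, zero_sub, mul_add]
    have h3 : (1 - a * y) * eval y (reciprocalPoly m) * (a / (1 - a * y)) =
      a * eval y (reciprocalPoly m) := by field_simp
    rw [h3]
    linear_combination (1 - a * y) * h1

lemma card_sq_le_sum_mul_sum_inv (s : Multiset ℝ) (f : ℝ → ℝ) (h : ∀ a ∈ s, 0 < f a) :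
    (s.card : ℝ) ^ 2 ≤ (s.map f).sum * (s.map fun a => (f a)⁻¹).sum := by
  induction s using Multiset.induction_on with
  | empty => simp
  | cons a s ih =>
    have h1 := ih fun c hc => h c (Multiset.mem_cons_of_mem hc)
    have h2 := h a (Multiset.mem_cons_self a s)
    simp only [Multiset.map_cons, Multiset.sum_cons, Multiset.card_cons]
    have hY : 0 ≤ (s.map f).sum := Multiset.sum_nonneg fun x hx => by
      obtain ⟨c, hc, rfl⟩ := Multiset.mem_map.mp hx
      exact (h c (Multiset.mem_cons_of_mem hc)).le
    have hW : 0 ≤ (s.map fun a => (f a)⁻¹).sum := Multiset.sum_nonneg fun x hx => by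
      obtain ⟨c, hc, rfl⟩ := Multiset.mem_map.mp hx
      exact inv_nonneg.mpr (h c (Multiset.mem_cons_of_mem hc)).le
    set Y := (s.map f).sum
    set W := (s.map fun a => (f a)⁻¹).sum
    have h3 : (2 * (s.card : ℝ)) ^ 2 ≤ (f a * W + Y * (f a)⁻¹) ^ 2 := by
      have : f a * W * (Y * (f a)⁻¹) = Y * W := by field_simp
      nlinarith [sq_nonneg (f a * W - Y * (f a)⁻¹)]
    have h4 : 2 * (s.card : ℝ) ≤ f a * W + Y * (f a)⁻¹ :=
      le_of_sq_le_sq h3 (by positivity)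
    have h5 : f a * (f a)⁻¹ = 1 := mul_inv_cancel₀ h2.ne'
    push_cast
    nlinarith

lemma reciprocal_root_shift_le {m : Multiset ℝ} {b B x : ℝ} (hm0 : 0 < m.card) (hb : 0 < b)
    (hB : 0 < B) (hx : 0 ≤ x)
    (hxb : x * (m.card * b - ((m.card : ℝ) - 1) ^ 2 * b ^ 2 / (((m.card : ℝ) - 1) * b + B)) ≤ m.card)
    (hm : ∀ a ∈ m, 0 ≤ a ∧ a < b) (hsum : (m.map fun a => a / (1 - a * b⁻¹)).sum ≤ B)
    {a : ℝ} (ha : a ∈ m) : x * ((b - a) + m.sum) ≤ m.card := by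
  set r : ℝ := (m.card : ℝ)
  obtain ⟨s, rfl⟩ := Multiset.exists_cons_of_mem ha
  have hr : (s.card : ℝ) = r - 1 := by simp [r]
  have hs : ∀ c ∈ s, 0 ≤ c ∧ c < b := fun c hc => hm c (Multiset.mem_cons_of_mem hc)
  have ha' := hm a ha
  rw [Multiset.map_cons, Multiset.sum_cons] at hsum
  have h1 : 0 ≤ a / (1 - a * b⁻¹) := by
    refine div_nonneg ha'.1 ?_
    rw [← div_eq_mul_inv, sub_nonneg, div_le_one hb]
    exact ha'.2.le
  have hW : (s.map fun a => a / (1 - a * b⁻¹)).sum =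
      b ^ 2 * (s.map fun a => (b - a)⁻¹).sum - s.card * b := by
    clear_value r
    clear hxb hsum h1 hr ha hm hm0
    induction s using Multiset.induction_on with
    | empty => simp
    | cons c s ih =>
      simp only [Multiset.map_cons, Multiset.sum_cons, Multiset.card_cons]
      rw [ih fun d hd => hs d (Multiset.mem_cons_of_mem hd)]
      have h2 := (hs c (Multiset.mem_cons_self c s)).2
      have h3 : c / (1 - c * b⁻¹) = b ^ 2 * (b - c)⁻¹ - b := by
        have : b - c ≠ 0 := by linarith
        have h4 : 1 - c * b⁻¹ ≠ 0 := by
          rw [← div_eq_mul_inv, one_sub_div hb.ne']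
          exact div_ne_zero this hb.ne'
        field_simp
        ring
      rw [h3]; push_cast; ring
  have hY : (s.map fun a => b - a).sum = s.card * b - s.sum := by
    rw [Multiset.sum_map_sub]; simp
  have hCS := card_sq_le_sum_mul_sum_inv s (fun a => b - a) fun c hc => by linarith [(hs c hc).2]
  have hYnn : 0 ≤ (s.map fun a => b - a).sum := Multiset.sum_nonneg fun y hy => by
    obtain ⟨c, hc, rfl⟩ := Multiset.mem_map.mp hy
    linarith [(hs c hc).2]
  set Y := (s.map fun a => b - a).sum
  set W := (s.map fun a => (b - a)⁻¹).sum
  rw [hr] at hW hCS hY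
  have hr1 : 0 ≤ r - 1 := by rw [← hr]; positivity
  have hD : 0 < (r - 1) * b + B := by positivity
  have h5 : (r - 1) ^ 2 * b ^ 2 / ((r - 1) * b + B) ≤ Y := by
    rw [div_le_iff₀ hD]
    have h6 : b ^ 2 * W ≤ (r - 1) * b + B := by linarith
    calc (r - 1) ^ 2 * b ^ 2 ≤ Y * W * b ^ 2 := by gcongr
      _ = Y * (b ^ 2 * W) := by ring
      _ ≤ _ := by gcongr
  have h7 : b - a + (a ::ₘ s).sum ≤ r * b - (r - 1) ^ 2 * b ^ 2 / ((r - 1) * b + B) := by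
    rw [Multiset.sum_cons]
    linarith
  exact (mul_le_mul_of_nonneg_left h7 hx).trans hxb

section MixedAlgebra

open Function

lemma comp_update₂ {ι κ α β : Type*} [DecidableEq ι] (φ : α → β) (Y : ι → κ → α) (i : ι) (w : κ → α) :
    (fun k l => φ (update Y i w k l)) = update (fun k l => φ (Y k l)) i fun l => φ (w l) := by
  ext k l
  rcases eq_or_ne k i with rfl | h
  · simp
  · simp [h]

lemma comp_update₁ {κ α β : Type*} [DecidableEq κ] (φ : α → β) (w : κ → α) (l : κ) (t : α) :
    (fun k => φ (update w l t k)) = update (fun k => φ (w k)) l (φ t) := by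
  ext k
  rcases eq_or_ne k l with rfl | h
  · simp
  · simp [h]

lemma sum_sum_eq_card_mul_of_update {ι κ R : Type*} [CommRing R] [Fintype ι] [DecidableEq ι]
    [Fintype κ] {F : (ι → κ) → κ → R} (i : ι)
    (hF : ∀ c j l, F (update c i l) j = F c j) :
    ∑ c, ∑ j, F c j = Fintype.card κ * ∑ c, F c (c i) := by
  have hinv : Involutive fun p : (ι → κ) × κ => (update p.1 i p.2, p.1 i) := fun p => by simp
  have := Equiv.sum_comp hinv.toPerm fun p : (ι → κ) × κ => F p.1 p.2
  rw [Fintype.sum_prod_type, Fintype.sum_prod_type] at this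
  rw [← this, Finset.mul_sum]
  refine Finset.sum_congr rfl fun c _ => ?_
  simp [hF]

variable {ι κ R R' : Type*} [CommRing R] [Algebra ℝ R] [CommRing R'] [Algebra ℝ R']

/-- The multi-affine polynomial `∑ s, μ s ∏_{k ∈ s} (-d k)`. When `μ` records the principal minors
of `A`, its value is `det (1 - diag(d) A)`. -/
noncomputable def multiAffine [Fintype ι] (μ : Finset ι → ℝ) (d : ι → R) : R :=
  ∑ s, algebraMap ℝ R (μ s) * ∏ k ∈ s, -d k

lemma map_multiAffine [Fintype ι] (φ : R →ₐ[ℝ] R') (μ : Finset ι → ℝ) (d : ι → R) :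
    φ (multiAffine μ d) = multiAffine μ fun k => φ (d k) := by
  simp [multiAffine, map_sum, map_prod]

variable [Fintype ι] [DecidableEq ι]

lemma multiAffine_update (μ : Finset ι → ℝ) (d : ι → R) (i : ι) (t : R) :
    multiAffine μ (update d i t) = multiAffine μ (update d i 0) +
      t * (multiAffine μ (update d i 1) - multiAffine μ (update d i 0)) := by
  simp only [multiAffine]
  rw [← Finset.sum_sub_distrib, Finset.mul_sum, ← Finset.sum_add_distrib]
  refine Finset.sum_congr rfl fun s _ => ?_
  by_cases hi : i ∈ s
  · have h : ∀ t : R, ∏ k ∈ s, -update d i t k = -t * ∏ k ∈ s.erase i, -d k := fun t => by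
      rw [← Finset.mul_prod_erase s _ hi, update_self]
      congr 1
      exact Finset.prod_congr rfl fun k hk => by rw [update_of_ne (Finset.ne_of_mem_erase hk)]
    rw [h, h, h]
    ring
  · have h : ∀ t : R, ∏ k ∈ s, -update d i t k = ∏ k ∈ s, -d k := fun t =>
      Finset.prod_congr rfl fun k hk => by rw [update_of_ne (by rintro rfl; exact hi hk)]
    rw [h, h, h]
    ring

lemma multiAffine_update_zero (μ : Finset ι → ℝ) (i : ι) (t : R) :
    multiAffine μ (update (0 : ι → R) i t) = algebraMap ℝ R (μ ∅) - t * algebraMap ℝ R (μ {i}) := by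
  rw [multiAffine, ← Finset.sum_subset (Finset.subset_univ {∅, {i}}),
    Finset.sum_pair (Finset.singleton_ne_empty i).symm]
  · simp; ring
  · intro s _ hs
    obtain ⟨k, hk, hki⟩ : ∃ k ∈ s, k ≠ i := by
      by_contra! h
      have := Finset.subset_singleton_iff.mp fun k hk => Finset.mem_singleton.mpr (h k hk)
      simp at hs
      tauto
    rw [Finset.prod_eq_zero hk (by simp [hki]), mul_zero]

variable [DecidableEq κ]

/-- The constant term of a factor of `mixed`, as a polynomial in row `i`. -/
noncomputable def rowConst (μ : Finset ι → ℝ) (S : Finset ι) (Y : ι → κ → R) (i : ι) (c : ι → κ)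
    (j : κ) : R :=
  multiAffine μ (update (fun k => if k ∈ S ∧ c k ≠ j then 0 else Y k j) i 0)

/-- The slope of a factor of `mixed`, as a polynomial in row `i`. -/
noncomputable def rowSlope (μ : Finset ι → ℝ) (S : Finset ι) (Y : ι → κ → R) (i : ι) (c : ι → κ)
    (j : κ) : R :=
  multiAffine μ (update (fun k => if k ∈ S ∧ c k ≠ j then 0 else Y k j) i 1) -
    rowConst μ S Y i c j

lemma map_rowConst (φ : R →ₐ[ℝ] R') (μ : Finset ι → ℝ) (S : Finset ι) (Y : ι → κ → R) (i : ι)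
    (c : ι → κ) (j : κ) :
    φ (rowConst μ S Y i c j) = rowConst μ S (fun k l => φ (Y k l)) i c j := by
  rw [rowConst, map_multiAffine, rowConst]
  congr 1
  ext k
  rcases eq_or_ne k i with rfl | h
  · simp
  · simp [h, apply_ite φ]

lemma map_rowSlope (φ : R →ₐ[ℝ] R') (μ : Finset ι → ℝ) (S : Finset ι) (Y : ι → κ → R) (i : ι)
    (c : ι → κ) (j : κ) :
    φ (rowSlope μ S Y i c j) = rowSlope μ S (fun k l => φ (Y k l)) i c j := by
  rw [rowSlope, map_sub, map_multiAffine, map_rowConst, rowSlope]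
  congr 2
  ext k
  rcases eq_or_ne k i with rfl | h
  · simp
  · simp [h, apply_ite φ]

variable [Fintype κ]

/-- The product over `j : κ` of the values of `multiAffine μ` on the columns of `Y`, summed over all
colourings `c` of `ι`, where a row `k ∈ S` only keeps its entry of colour `c k`. -/
noncomputable def mixed (μ : Finset ι → ℝ) (S : Finset ι) (Y : ι → κ → R) : R :=
  ∑ c : ι → κ, ∏ j, multiAffine μ fun k => if k ∈ S ∧ c k ≠ j then 0 else Y k j

lemma map_mixed (φ : R →ₐ[ℝ] R') (μ : Finset ι → ℝ) (S : Finset ι) (Y : ι → κ → R) :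
    φ (mixed μ S Y) = mixed μ S fun k j => φ (Y k j) := by
  simp only [mixed, map_sum, map_prod, map_multiAffine]
  simp only [apply_ite φ, map_zero]

lemma mixed_empty (μ : Finset ι → ℝ) (Y : ι → κ → R) :
    mixed μ ∅ Y = Fintype.card (ι → κ) * ∏ j, multiAffine μ fun k => Y k j := by
  simp [mixed]

variable {μ : Finset ι → ℝ} {S : Finset ι} {i : ι}

lemma mixed_update (hi : i ∉ S) (Y : ι → κ → R) (w : κ → R) :
    mixed μ S (update Y i w) =
      ∑ c : ι → κ, ∏ j, (rowConst μ S Y i c j + w j * rowSlope μ S Y i c j) := by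
  refine Finset.sum_congr rfl fun c _ => Finset.prod_congr rfl fun j _ => ?_
  rw [rowSlope, rowConst, ← multiAffine_update]
  congr 1
  ext k
  rcases eq_or_ne k i with rfl | h
  · simp [hi]
  · simp [h]

lemma mixed_update_update (hi : i ∉ S) (Y : ι → κ → R) (w : κ → R) (l : κ) (t : R) :
    mixed μ S (update Y i (update w l t)) = mixed μ S (update Y i (update w l 0)) +
      t * (mixed μ S (update Y i (update w l 1)) - mixed μ S (update Y i (update w l 0))) := by
  simp only [mixed_update hi]
  rw [← Finset.sum_sub_distrib, Finset.mul_sum, ← Finset.sum_add_distrib]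
  refine Finset.sum_congr rfl fun c _ => ?_
  have h : ∀ t : R, ∏ j, (rowConst μ S Y i c j + update w l t j * rowSlope μ S Y i c j) =
      (rowConst μ S Y i c l + t * rowSlope μ S Y i c l) *
        ∏ j ∈ Finset.univ.erase l, (rowConst μ S Y i c j + w j * rowSlope μ S Y i c j) := by
    intro t
    rw [← Finset.mul_prod_erase _ _ (Finset.mem_univ l), update_self]
    congr 1
    exact Finset.prod_congr rfl fun k hk => by rw [update_of_ne (Finset.ne_of_mem_erase hk)]
  rw [h, h, h]
  ring

lemma card_mul_mixed_insert (hi : i ∉ S) (Y : ι → κ → R) :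
    Fintype.card κ * mixed μ (insert i S) Y =
      ∑ j, mixed μ S (update Y i (update 0 j (Y i j))) := by
  have h : ∀ j, mixed μ S (update Y i (update 0 j (Y i j))) = ∑ c : ι → κ, ∏ l,
      (rowConst μ S Y i c l + update (0 : κ → R) j (Y i j) l * rowSlope μ S Y i c l) := fun j => by
    rw [mixed_update hi]
  simp only [h]
  rw [Finset.sum_comm, sum_sum_eq_card_mul_of_update i, mixed]
  · congr 1
    refine Finset.sum_congr rfl fun c _ => Finset.prod_congr rfl fun l _ => ?_
    rw [rowSlope, rowConst, ← multiAffine_update]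
    congr 1
    ext k
    rcases eq_or_ne k i with rfl | hk
    · rcases eq_or_ne l (c k) with rfl | hl
      · simp
      · simp [hl, hl.symm]
    · simp [hk]
  · intro c j l
    refine Finset.prod_congr rfl fun l' _ => ?_
    have : (fun k => if k ∈ S ∧ update c i l k ≠ l' then 0 else Y k l') =
        fun k => if k ∈ S ∧ c k ≠ l' then 0 else Y k l' := by
      ext k
      rcases eq_or_ne k i with rfl | hk
      · simp [hi]
      · simp [hk]
    simp only [rowSlope, rowConst, this]

lemma mixed_update_zero (h0 : μ ∅ = 1) (hi : i ∉ S) (w : κ → R) :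
    mixed μ S (update (0 : ι → κ → R) i w) =
      Fintype.card (ι → κ) * ∏ j, (1 - w j * algebraMap ℝ R (μ {i})) := by
  rw [mixed_update hi]
  have h : ∀ c j, rowConst μ S (0 : ι → κ → R) i c j + w j * rowSlope μ S 0 i c j =
      1 - w j * algebraMap ℝ R (μ {i}) := fun c j => by
    have : (fun k => if k ∈ S ∧ c k ≠ j then (0 : R) else (0 : ι → κ → R) k j) = 0 := by
      ext; simp
    rw [rowSlope, rowConst, ← multiAffine_update, this, multiAffine_update_zero, h0, map_one]
  simp [h]

/-- The negative of the derivative of `mixed` along row `j`. -/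
noncomputable def rowDeriv (μ : Finset ι → ℝ) (S : Finset ι) (Y : ι → κ → R) (j : ι) : R :=
  ∑ l, (mixed μ S (update Y j (update (Y j) l 0)) - mixed μ S (update Y j (update (Y j) l 1)))

/-- `mixed`, as a polynomial in the common value of the entries of row `i`. -/
noncomputable def rowPoly (μ : Finset ι → ℝ) (S : Finset ι) (Y : ι → κ → R) (i : ι) : R[X] :=
  mixed μ S (update (fun k l => C (Y k l)) i fun _ => X)

lemma map_rowDeriv (φ : R →ₐ[ℝ] R') (μ : Finset ι → ℝ) (S : Finset ι) (Y : ι → κ → R) (j : ι) :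
    φ (rowDeriv μ S Y j) = rowDeriv μ S (fun k l => φ (Y k l)) j := by
  simp only [rowDeriv, map_sum, map_sub, map_mixed, comp_update₂ φ, comp_update₁ φ, map_zero,
    map_one]

lemma eval_rowPoly (Y : ι → κ → R) (x : R) :
    (rowPoly μ S Y i).eval x = mixed μ S (update Y i fun _ => x) := by
  have := map_mixed ((aeval x : R[X] →ₐ[R] R).restrictScalars ℝ) μ S
    (update (fun k l => C (Y k l)) i fun _ => X)
  rw [comp_update₂] at this
  simpa [rowPoly] using this

lemma rowPoly_eq_sum (hi : i ∉ S) (Y : ι → κ → R) :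
    rowPoly μ S Y i =
      ∑ c : ι → κ, ∏ j, (C (rowConst μ S Y i c j) + X * C (rowSlope μ S Y i c j)) := by
  rw [rowPoly, mixed_update hi]
  refine Finset.sum_congr rfl fun c _ => Finset.prod_congr rfl fun j _ => ?_
  have h1 := map_rowConst (CAlgHom : R →ₐ[ℝ] R[X]) μ S Y i c j
  have h2 := map_rowSlope (CAlgHom : R →ₐ[ℝ] R[X]) μ S Y i c j
  rw [CAlgHom_apply] at h1 h2
  simp only [CAlgHom_apply] at h1 h2
  rw [h1, h2]

lemma natDegree_rowPoly_le (hi : i ∉ S) (Y : ι → κ → R) :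
    (rowPoly μ S Y i).natDegree ≤ Fintype.card κ := by
  rw [rowPoly_eq_sum hi]
  refine natDegree_sum_le_of_forall_le _ _ fun c _ => ?_
  refine (natDegree_prod_le _ _).trans ?_
  refine (Finset.sum_le_card_nsmul _ _ 1 fun j _ => ?_).trans (by simp)
  rw [add_comm, mul_comm]
  exact natDegree_linear_le

lemma derivative_rowPoly_eval (hi : i ∉ S) (Y : ι → κ → R) (x : R) :
    (rowPoly μ S Y i).derivative.eval x = -rowDeriv μ S (update Y i fun _ => x) i := by
  rw [rowPoly_eq_sum hi, derivative_sum, eval_finsetSum, rowDeriv, ← Finset.sum_neg_distrib]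
  simp only [update_idem, update_self, mixed_update hi, neg_sub]
  simp only [← Finset.sum_sub_distrib]
  rw [Finset.sum_comm]
  refine Finset.sum_congr rfl fun c _ => ?_
  rw [derivative_prod_finset, eval_finsetSum]
  refine Finset.sum_congr rfl fun l _ => ?_
  have h : ∀ t : R, ∏ j, (rowConst μ S Y i c j + update (fun _ => x) l t j * rowSlope μ S Y i c j) =
      (rowConst μ S Y i c l + t * rowSlope μ S Y i c l) *
        ∏ j ∈ Finset.univ.erase l, (rowConst μ S Y i c j + x * rowSlope μ S Y i c j) := by
    intro t
    rw [← Finset.mul_prod_erase _ _ (Finset.mem_univ l), update_self]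
    congr 1
    exact Finset.prod_congr rfl fun k hk => by rw [update_of_ne (Finset.ne_of_mem_erase hk)]
  rw [h, h]
  simp [eval_prod]
  ring_nf

lemma card_mul_mixed_insert_eq_coeff (hi : i ∉ S) {Y : ι → κ → R} {x : R} (hx : ∀ l, Y i l = x) :
    Fintype.card κ * mixed μ (insert i S) Y =
      Fintype.card κ * (rowPoly μ S Y i).coeff 0 + x * (rowPoly μ S Y i).coeff 1 := by
  have h0 : (rowPoly μ S Y i).coeff 0 = mixed μ S (update Y i 0) := by
    rw [coeff_zero_eq_eval_zero, eval_rowPoly]; rfl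
  have h1 : (rowPoly μ S Y i).coeff 1 =
      ∑ l, (mixed μ S (update Y i (update 0 l 1)) - mixed μ S (update Y i 0)) := by
    have : (rowPoly μ S Y i).coeff 1 = (rowPoly μ S Y i).derivative.eval 0 := by
      rw [← coeff_zero_eq_eval_zero, coeff_derivative]; simp
    rw [this, derivative_rowPoly_eval hi, rowDeriv, ← Finset.sum_neg_distrib]
    refine Finset.sum_congr rfl fun l _ => ?_
    have : (fun _ : κ => (0 : R)) = 0 := rfl
    rw [update_self, update_idem, update_idem, this, neg_sub]
    congr 3
    exact update_eq_self l (0 : κ → R)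
  rw [card_mul_mixed_insert hi, h0, h1, Finset.mul_sum]
  have h2 : ∀ j, mixed μ S (update Y i (update 0 j (Y i j))) = mixed μ S (update Y i 0) +
      x * (mixed μ S (update Y i (update 0 j 1)) - mixed μ S (update Y i 0)) := fun j => by
    have : update (0 : κ → R) j 0 = 0 := update_eq_self j (0 : κ → R)
    rw [mixed_update_update hi, hx, this]
  simp only [h2, Finset.sum_add_distrib]
  simp

lemma continuous_mixed [TopologicalSpace R] [IsTopologicalRing R] (μ : Finset ι → ℝ)
    (S : Finset ι) : Continuous fun Y : ι → κ → R => mixed μ S Y := by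
  unfold mixed multiAffine
  refine continuous_finsetSum _ fun c _ => continuous_finsetProd _ fun j _ =>
    continuous_finsetSum _ fun s _ => continuous_const.mul (continuous_finsetProd _ fun k _ => ?_)
  by_cases h : k ∈ S ∧ c k ≠ j
  · simpa [h] using continuous_const
  · simp only [h, if_false]; fun_prop

end MixedAlgebra

section MixedAnalysis

open Function

variable {ι κ : Type*} [Fintype ι] [DecidableEq ι] [Fintype κ] [DecidableEq κ]
  {μ : Finset ι → ℝ} {S : Finset ι} {i j : ι}

lemma mixed_ne_zero [Nonempty κ]
    (hμ : ∀ d : ι → ℂ, (∀ k, InUpper (d k)) → multiAffine μ d ≠ 0) :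
    ∀ (S : Finset ι) (Y : ι → κ → ℂ), (∀ k l, InUpper (Y k l)) →
      (∀ k ∈ S, ∀ l l', Y k l = Y k l') → mixed μ S Y ≠ 0 := by
  intro S
  induction S using Finset.induction_on with
  | empty =>
    intro Y hY _
    rw [mixed_empty]
    exact mul_ne_zero (by simp) (Finset.prod_ne_zero_iff.mpr fun l _ => hμ _ fun k => hY k l)
  | insert i S hi ih =>
    intro Y hY hS h0
    obtain ⟨l₀⟩ := ‹Nonempty κ›
    have hr : (0 : ℝ) < Fintype.card κ := by exact_mod_cast Fintype.card_pos
    have hx := card_mul_mixed_insert_eq_coeff (μ := μ) hi (Y := Y) (x := Y i l₀)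
      fun l => hS i (Finset.mem_insert_self i S) l l₀
    have h1 := first_order_truncation_ne_zero (rowPoly μ S Y i) (fun z hz => ?_) hr (hY i l₀)
    · rw [h0, mul_zero] at hx
      apply h1
      have hr' : (Fintype.card κ : ℂ) ≠ 0 := by exact_mod_cast hr.ne'
      push_cast
      field_simp
      linear_combination -hx
    · rw [eval_rowPoly]
      refine ih _ (fun k l => ?_) fun k hk l l' => ?_
      · rcases eq_or_ne k i with rfl | h
        · simpa using hz
        · simpa [h] using hY k l
      · have h : k ≠ i := by rintro rfl; exact hi hk
        simpa [h] using hS k (Finset.mem_insert_of_mem hk) l l'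

/-- The half-plane inequality behind all the interlacing statements. -/
lemma im_mixed_sub_mul_conj_nonneg [Nonempty κ]
    (hμ : ∀ d : ι → ℂ, (∀ k, InUpper (d k)) → multiAffine μ d ≠ 0)
    (hj : j ∉ S) {Y : ι → κ → ℂ} (hY : ∀ k l, 0 ≤ (Y k l).im)
    (hS : ∀ k ∈ S, ∀ l l', Y k l = Y k l') {l : κ} {t : ℝ} (ht : Y j l = t) :
    0 ≤ ((mixed μ S (update Y j (update (Y j) l 0)) - mixed μ S (update Y j (update (Y j) l 1))) *
      conj (mixed μ S Y)).im := by
  have strict : ∀ Y : ι → κ → ℂ, (∀ k l, InUpper (Y k l)) →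
      (∀ k ∈ S, ∀ l l', Y k l = Y k l') → 0 ≤ ((mixed μ S (update Y j (update (Y j) l 0)) -
        mixed μ S (update Y j (update (Y j) l 1))) *
          conj (mixed μ S (update Y j (update (Y j) l 0)))).im := by
    intro Y hY hS
    have hM : ∀ u : ℂ, InUpper u → mixed μ S (update Y j (update (Y j) l u)) ≠ 0 := by
      intro u hu
      refine mixed_ne_zero hμ S _ (fun k l' => ?_) fun k hk l' l'' => ?_
      · rcases eq_or_ne k j with rfl | h
        · rcases eq_or_ne l' l with rfl | h'
          · simpa using hu
          · simpa [h'] using hY k l'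
        · simpa [h] using hY k l'
      · have h : k ≠ j := by rintro rfl; exact hj hk
        simpa [h] using hS k hk l' l''
    have hM' := fun t ht => mixed_update_update hj Y (Y j) l t ▸ hM t ht
    set M0 := mixed μ S (update Y j (update (Y j) l 0))
    set M1 := mixed μ S (update Y j (update (Y j) l 1))
    by_cases hK : M0 - M1 = 0
    · rw [hK]; simp
    · have h1 : ¬ 0 < (M0 / (M0 - M1)).im := fun h => by
        refine hM' _ (Or.inr h) ?_
        field_simp
        ring
      rw [← not_lt]
      intro h2
      apply h1
      have h3 : M0 / (M0 - M1) = ((Complex.normSq (M0 - M1))⁻¹ : ℝ) * (M0 * conj (M0 - M1)) := by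
        rw [div_eq_mul_inv, Complex.inv_def]
        ring
      rw [h3, Complex.im_ofReal_mul]
      refine mul_pos (inv_pos.mpr (Complex.normSq_pos.mpr hK)) ?_
      have h4 : M0 * conj (M0 - M1) = conj ((M0 - M1) * conj M0) := by
        rw [map_mul, Complex.conj_conj, mul_comm]
      rw [h4, Complex.conj_im]
      linarith
  have weak : 0 ≤ ((mixed μ S (update Y j (update (Y j) l 0)) -
        mixed μ S (update Y j (update (Y j) l 1))) *
          conj (mixed μ S (update Y j (update (Y j) l 0)))).im := by
    let Z : ℝ → ι → κ → ℂ := fun ε k l => Y k l + ε * Complex.I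
    have hZ : Continuous Z := by fun_prop
    have hZ0 : Z 0 = Y := by ext; simp [Z]
    have hcont : Continuous fun ε : ℝ =>
        ((mixed μ S (update (Z ε) j (update (Z ε j) l 0)) -
          mixed μ S (update (Z ε) j (update (Z ε j) l 1))) *
            conj (mixed μ S (update (Z ε) j (update (Z ε j) l 0)))).im := by
      have h1 : ∀ t : ℂ, Continuous fun ε => mixed μ S (update (Z ε) j (update (Z ε j) l t)) :=
        fun t => (continuous_mixed μ S).comp
          (hZ.update j (((continuous_apply j).comp hZ).update l continuous_const))
      exact Complex.continuous_im.comp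
        (((h1 0).sub (h1 1)).mul (Complex.continuous_conj.comp (h1 0)))
    have h2 : ∀ ε : ℝ, 0 < ε → 0 ≤ ((mixed μ S (update (Z ε) j (update (Z ε j) l 0)) -
        mixed μ S (update (Z ε) j (update (Z ε j) l 1))) *
          conj (mixed μ S (update (Z ε) j (update (Z ε j) l 0)))).im := by
      intro ε hε
      refine strict _ (fun k l => Or.inr ?_) fun k hk l l' => ?_
      · have := hY k l
        simp [Z]; linarith
      · simp [Z, hS k hk l l']
    have h3 := ge_of_tendsto ((hcont.tendsto 0).mono_left
      (nhdsWithin_le_nhds (s := Set.Ioi 0)))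
      (Filter.eventually_of_mem self_mem_nhdsWithin fun ε hε => h2 ε hε)
    rwa [hZ0] at h3
  have h5 : mixed μ S Y = mixed μ S (update Y j (update (Y j) l (t : ℂ))) := by
    rw [← ht, update_eq_self, update_eq_self]
  rw [h5, mixed_update_update hj Y (Y j) l t]
  set M0 := mixed μ S (update Y j (update (Y j) l 0))
  set M1 := mixed μ S (update Y j (update (Y j) l 1))
  have h6 : (M0 - M1) * conj (M0 + t * (M1 - M0)) =
      (M0 - M1) * conj M0 - ((t * Complex.normSq (M0 - M1) : ℝ) : ℂ) := by
    push_cast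
    rw [← Complex.mul_conj]
    simp
    ring
  rw [h6, Complex.sub_im, Complex.ofReal_im, sub_zero]
  exact weak

lemma aeval_mixed (Y : ι → κ → ℝ[X]) (z : ℂ) :
    aeval z (mixed μ S Y) = mixed μ S fun k l => aeval z (Y k l) :=
  map_mixed (aeval z) μ S Y

lemma eval_mixed (Y : ι → κ → ℝ[X]) (x : ℝ) :
    (mixed μ S Y).eval x = mixed μ S fun k l => (Y k l).eval x := by
  simpa only [coe_aeval_eq_eval] using map_mixed (aeval x) μ S Y

lemma nevanlinnaPair_mixed [Nonempty κ]
    (hμ : ∀ d : ι → ℂ, (∀ k, InUpper (d k)) → multiAffine μ d ≠ 0)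
    (hj : j ∉ S) {Y : ι → κ → ℝ[X]} (hY : ∀ k l (z : ℂ), 0 < z.im → 0 ≤ (aeval z (Y k l)).im)
    (hS : ∀ k ∈ S, ∀ l l', Y k l = Y k l') {l : κ} {t : ℝ} (ht : Y j l = C t) :
    NevanlinnaPair (mixed μ S (update Y j (update (Y j) l 0)) -
      mixed μ S (update Y j (update (Y j) l 1))) (mixed μ S Y) := by
  intro z hz
  have := im_mixed_sub_mul_conj_nonneg hμ hj (Y := fun k l => aeval z (Y k l))
    (fun k l => hY k l z hz) (fun k hk l l' => by rw [hS k hk l l']) (l := l) (t := t)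
    (by simp [ht])
  rw [map_sub, aeval_mixed, aeval_mixed, aeval_mixed, comp_update₂, comp_update₂, comp_update₁,
    comp_update₁, map_zero, map_one]
  exact this

lemma NevanlinnaPair.finset_sum {α : Type*} {s : Finset α} {K : α → ℝ[X]} {G : ℝ[X]}
    (h : ∀ a ∈ s, NevanlinnaPair (K a) G) : NevanlinnaPair (∑ a ∈ s, K a) G := by
  intro z hz
  rw [map_sum, Finset.sum_mul, Complex.im_sum]
  exact Finset.sum_nonneg fun a ha => h a ha z hz

lemma aeval_rowPoly (Y : ι → κ → ℝ) (z : ℂ) : aeval z (rowPoly μ S Y i) =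
    mixed μ S (update (fun k l => (Y k l : ℂ)) i fun _ => z) := by
  rw [rowPoly, aeval_mixed, comp_update₂]
  simp

/-- Restricting `mixed` to one real row gives a polynomial without zeros in the upper half-plane. -/
lemma aeval_rowPoly_ne_zero [Nonempty κ]
    (hμ : ∀ d : ι → ℂ, (∀ k, InUpper (d k)) → multiAffine μ d ≠ 0)
    (hi : i ∉ S) {Y : ι → κ → ℝ} (hS : ∀ k ∈ S, ∀ l l', Y k l = Y k l')
    (h0 : (rowPoly μ S Y i).eval 0 ≠ 0) {w : ℂ} (hw : 0 < w.im) :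
    aeval w (rowPoly μ S Y i) ≠ 0 := by
  let Z : ℝ → ι → κ → ℂ := fun ε k l => Y k l + ε * Complex.I
  have hZ : Continuous Z := by fun_prop
  have hbound : ∀ ε : ℝ, 0 < ε → ‖mixed μ S (update (Z ε) i fun _ => 0)‖ ≤
      (1 + ‖0 - w‖ / w.im) ^ Fintype.card κ * ‖mixed μ S (update (Z ε) i fun _ => w)‖ := by
    intro ε hε
    rw [← eval_rowPoly, ← eval_rowPoly]
    refine norm_eval_le_of_forall_im_pos_ne_zero _ (fun z hz => ?_)
      (natDegree_rowPoly_le hi _) hw 0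
    rw [eval_rowPoly]
    refine mixed_ne_zero hμ S _ (fun k l => Or.inr ?_) fun k hk l l' => ?_
    · rcases eq_or_ne k i with rfl | h
      · simpa using hz
      · simpa [h, Z] using hε
    · have h : k ≠ i := by rintro rfl; exact hi hk
      simp [h, Z, hS k hk l l']
  have hcont : ∀ x : ℂ, Continuous fun ε => ‖mixed μ S (update (Z ε) i fun _ => x)‖ :=
    fun x => ((continuous_mixed μ S).comp (hZ.update i continuous_const)).norm
  have hlim : ‖mixed μ S (update (Z 0) i fun _ => 0)‖ ≤
      (1 + ‖0 - w‖ / w.im) ^ Fintype.card κ * ‖mixed μ S (update (Z 0) i fun _ => w)‖ :=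
    le_of_tendsto_of_tendsto
    (((hcont 0).tendsto 0).mono_left (nhdsWithin_le_nhds (s := Set.Ioi 0)))
    (((continuous_const.mul (hcont w)).tendsto 0).mono_left (nhdsWithin_le_nhds (s := Set.Ioi 0)))
    (Filter.eventually_of_mem self_mem_nhdsWithin fun ε hε => hbound ε hε)
  have hZ0 : Z 0 = fun k l => (Y k l : ℂ) := by ext; simp [Z]
  rw [hZ0, ← aeval_rowPoly, ← aeval_rowPoly] at hlim
  intro h
  rw [h, norm_zero, mul_zero, norm_le_zero_iff, ← Complex.ofReal_zero, aeval_ofReal_complex] at hlim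
  exact h0 (by exact_mod_cast hlim)

end MixedAnalysis

section Barrier

open Function

/-- The properties of the principal minors of a positive semidefinite matrix that are used below. -/
structure IsStableFamily {ι : Type*} [Fintype ι] (μ : Finset ι → ℝ) : Prop where
  ne_zero : ∀ d : ι → ℂ, (∀ k, InUpper (d k)) → multiAffine μ d ≠ 0
  empty : μ ∅ = 1
  singleton_nonneg : ∀ i, 0 ≤ μ {i}

lemma const_update {ι κ α : Type*} [DecidableEq ι] (y : ι → α) (i : ι) (x : α) :
    (fun k (_ : κ) => update y i x k) = update (fun k _ => y k) i fun _ => x := by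
  ext k l
  rcases eq_or_ne k i with rfl | h
  · simp
  · simp [h]

variable {ι κ : Type*} [Fintype ι] [DecidableEq ι] [Fintype κ] [DecidableEq κ]
  {μ : Finset ι → ℝ} {S : Finset ι} {i : ι}

variable (κ) in
/-- A barrier for `mixed μ S`: positivity on a box, and a bound for the logarithmic derivatives. -/
def HasBarrier (μ : Finset ι → ℝ) (S : Finset ι) (y₀ y₁ B : ℝ) : Prop :=
  ∀ y : ι → ℝ, (∀ k, 0 ≤ y k) → (∀ k ∈ S, y k ≤ y₁) → (∀ k ∉ S, y k ≤ y₀) →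
    0 < mixed μ S (fun k (_ : κ) => y k) ∧
    ∀ j ∉ S, rowDeriv μ S (fun k (_ : κ) => y k) j ≤ B * mixed μ S fun k (_ : κ) => y k

lemma mixed_update_neg_pos [Nonempty κ] (hμ : IsStableFamily μ) (hi : i ∉ S) {y : ι → ℝ}
    (hy : ∀ k, 0 ≤ y k) {x : ℝ} (hx : x < 0)
    (hpos : ∀ s ∈ Set.Icc (0 : ℝ) 1, 0 < mixed μ S (update (fun k (_ : κ) => y k * s) i 0)) :
    0 < mixed μ S (update (fun k (_ : κ) => y k) i fun _ => x) := by
  let Y : ι → κ → ℝ[X] := fun k _ => C (y k) * X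
  let row : Finset κ → κ → ℝ[X] := fun T l => if l ∈ T then C x else 0
  let G : Finset κ → ℝ[X] := fun T => mixed μ S (update Y i (row T))
  have hGeval : ∀ (w : κ → ℝ[X]) (s : ℝ), (mixed μ S (update Y i w)).eval s =
      mixed μ S (update (fun k (_ : κ) => y k * s) i fun l => (w l).eval s) := by
    intro w s
    rw [eval_mixed, comp_update₂ (fun p : ℝ[X] => p.eval s)]
    simp [Y]
  have hGzero : ∀ w : κ → ℝ[X], (mixed μ S (update Y i w)).eval 0 =
      Fintype.card (ι → κ) * ∏ l, (1 - (w l).eval 0 * μ {i}) := by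
    intro w
    have h0 : (fun k (_ : κ) => y k * 0) = (0 : ι → κ → ℝ) := by ext; simp
    rw [hGeval, h0, mixed_update_zero hμ.empty hi]
    simp
  have hN : (0 : ℝ) < Fintype.card (ι → κ) := by exact_mod_cast Fintype.card_pos
  have hμi := hμ.singleton_nonneg i
  have main : ∀ T : Finset κ, ∀ s ∈ Set.Icc (0 : ℝ) 1, 0 < (G T).eval s := by
    intro T
    induction T using Finset.induction_on with
    | empty =>
      intro s hs
      have := hpos s hs
      simp only [G, hGeval]
      simp only [row, Finset.notMem_empty, if_false, eval_zero]
      exact this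
    | insert l T hl ih =>
      intro s hs
      set K := mixed μ S (update Y i (update (row T) l 0)) -
        mixed μ S (update Y i (update (row T) l 1)) with hK
      have hrow : update (row T) l 0 = row T := by
        rw [update_eq_self_iff]; simp [row, hl]
      have hrow' : row (insert l T) = update (row T) l (C x) := by
        ext1 l'
        rcases eq_or_ne l' l with rfl | h
        · simp [row]
        · simp [row, h]
      have hGK : G (insert l T) = G T - C x * K := by
        simp only [G, hrow', hK]
        rw [mixed_update_update hi, hrow]
        ring
      have hNev : NevanlinnaPair K (G T) := by
        have := nevanlinnaPair_mixed hμ.ne_zero hi (Y := update Y i (row T)) (l := l) (t := 0)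
          (fun k l' z hz => ?_) (fun k hk l' l'' => ?_) (by simp [row, hl])
        · simpa only [update_idem, update_self] using this
        · rcases eq_or_ne k i with rfl | h
          · rw [update_self]
            simp only [row]
            split_ifs <;> simp
          · simpa [h, Y] using mul_nonneg (hy k) hz.le
        · have h : k ≠ i := by rintro rfl; exact hi hk
          simp [h, Y]
      have hmono := hNev.monotoneOn_div (convex_Icc (0 : ℝ) 1) fun s hs => (ih s hs).ne'
      have h0 : (0 : ℝ) ∈ Set.Icc (0 : ℝ) 1 := by simp
      have hK0 : 0 ≤ K.eval 0 := by
        rw [hK, eval_sub, hGzero, hGzero, ← mul_sub]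
        refine mul_nonneg hN.le ?_
        rw [← Finset.mul_prod_erase _ _ (Finset.mem_univ l),
          ← Finset.mul_prod_erase (a := l) _ (fun l' => 1 - (update (row T) l 1 l').eval 0 * μ {i})
            (Finset.mem_univ l)]
        have h1 : ∏ l' ∈ Finset.univ.erase l, (1 - (update (row T) l 1 l').eval 0 * μ {i}) =
            ∏ l' ∈ Finset.univ.erase l, (1 - (row T l').eval 0 * μ {i}) :=
          Finset.prod_congr rfl fun k hk => by rw [update_of_ne (Finset.ne_of_mem_erase hk)]
        have h2 : ∏ l' ∈ Finset.univ.erase l, (1 - (update (row T) l 0 l').eval 0 * μ {i}) =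
            ∏ l' ∈ Finset.univ.erase l, (1 - (row T l').eval 0 * μ {i}) :=
          Finset.prod_congr rfl fun k hk => by rw [update_of_ne (Finset.ne_of_mem_erase hk)]
        have h3 : 0 ≤ ∏ l' ∈ Finset.univ.erase l, (1 - (row T l').eval 0 * μ {i}) := by
          refine Finset.prod_nonneg fun l' _ => ?_
          simp only [row]
          split_ifs
          · rw [eval_C]; nlinarith
          · simp
        rw [h1, h2, update_self, update_self, ← sub_mul]
        refine mul_nonneg ?_ h3
        simpa using hμi
      have h4 : 0 ≤ K.eval s / (G T).eval s :=
        (div_nonneg hK0 (ih 0 h0).le).trans (hmono h0 hs hs.1)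
      have h5 : 0 ≤ K.eval s := by
        have := mul_nonneg h4 (ih s hs).le
        rwa [div_mul_cancel₀ _ (ih s hs).ne'] at this
      rw [hGK, eval_sub, eval_mul, eval_C]
      nlinarith [ih s hs]
  have := main Finset.univ 1 (by simp)
  simp only [G, hGeval] at this
  simpa [row] using this

lemma hasBarrier_insert [Nonempty κ] (hμ : IsStableFamily μ) (hi : i ∉ S) {b y₁ B : ℝ}
    (hb : 0 < b) (hB : 0 < B)
    (hy₁b : y₁ * (Fintype.card κ * b - ((Fintype.card κ : ℝ) - 1) ^ 2 * b ^ 2 /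
      (((Fintype.card κ : ℝ) - 1) * b + B)) ≤ Fintype.card κ)
    (h : HasBarrier κ μ S b⁻¹ y₁ B) : HasBarrier κ μ (insert i S) b⁻¹ y₁ B := by
  intro y hy hyS hyn
  set x := y i with hxdef
  have hx0 : 0 ≤ x := hy i
  have hx1 : x ≤ y₁ := hyS i (Finset.mem_insert_self i S)
  have hr : (0 : ℝ) < Fintype.card κ := by exact_mod_cast Fintype.card_pos
  set Y : ι → κ → ℝ := fun k _ => y k with hY
  have hb' : 0 < b⁻¹ := inv_pos.mpr hb
  -- the box condition for the old barrier
  have hbox : ∀ t, 0 ≤ t → t ≤ b⁻¹ → ∀ s ∈ Set.Icc (0 : ℝ) 1,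
      (∀ k, 0 ≤ update (fun k => y k * s) i t k) ∧
      (∀ k ∈ S, update (fun k => y k * s) i t k ≤ y₁) ∧
      (∀ k ∉ S, update (fun k => y k * s) i t k ≤ b⁻¹) := by
    intro t ht htb s hs
    have hys : ∀ k, y k * s ≤ y k := fun k => mul_le_of_le_one_right (hy k) hs.2
    refine ⟨fun k => ?_, fun k hk => ?_, fun k hk => ?_⟩
    · rcases eq_or_ne k i with rfl | hk
      · simpa using ht
      · simpa [hk] using mul_nonneg (hy k) hs.1
    · have hki : k ≠ i := by rintro rfl; exact hi hk
      simpa [hki] using (hys k).trans (hyS k (Finset.mem_insert_of_mem hk))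
    · rcases eq_or_ne k i with rfl | hki
      · simpa using htb
      · simpa [hki] using (hys k).trans (hyn k (by simp [hki, hk]))
  have hold := fun t ht htb s hs => h _ (hbox t ht htb s hs).1 (hbox t ht htb s hs).2.1
    (hbox t ht htb s hs).2.2
  simp only [const_update] at hold
  have hold1 := fun t ht htb => hold t ht htb 1 (by simp)
  simp only [mul_one, ← hY] at hold1
  set f := rowPoly μ S Y i with hf
  have hfpos : ∀ t, t ≤ b⁻¹ → 0 < f.eval t := by
    intro t ht
    rw [hf, eval_rowPoly]
    rcases le_or_gt 0 t with h0 | h0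
    · exact (hold1 t h0 ht).1
    · exact mixed_update_neg_pos hμ hi hy h0 fun s hs => (hold 0 le_rfl hb'.le s hs).1
  obtain ⟨m, hmcard, hfm⟩ := exists_eq_reciprocalPoly (Fintype.card κ) f
    (natDegree_rowPoly_le hi Y) (hfpos 0 hb'.le).ne'
    fun z hz => aeval_rowPoly_ne_zero hμ.ne_zero hi (fun _ _ _ _ => rfl) (hfpos 0 hb'.le).ne' hz
  set c := f.eval 0 with hc
  have hc0 : 0 < c := hfpos 0 hb'.le
  have hm : ∀ a ∈ m, 0 ≤ a ∧ a < b := by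
    intro a ha
    have hroot : a ≠ 0 → f.eval a⁻¹ = 0 := fun ha0 => by
      rw [hfm, eval_mul, eval_reciprocalPoly_eq_zero ha ha0, mul_zero]
    constructor
    · by_contra! hneg
      exact (hfpos a⁻¹ ((inv_lt_zero.mpr hneg).le.trans hb'.le)).ne' (hroot hneg.ne)
    · by_contra! hge
      exact (hfpos a⁻¹ (inv_anti₀ hb hge)).ne' (hroot (hb.trans_le hge).ne')
  have hfb : 0 < f.eval b⁻¹ := hfpos _ le_rfl
  have hsum : (m.map fun a => a / (1 - a * b⁻¹)).sum ≤ B := by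
    have h1 := derivative_reciprocalPoly_eval m (y := b⁻¹) fun a ha => by
      rw [← div_eq_mul_inv, one_sub_div hb.ne']
      exact (div_pos (sub_pos.mpr (hm a ha).2) hb).ne'
    have h2 : -f.derivative.eval b⁻¹ = f.eval b⁻¹ * (m.map fun a => a / (1 - a * b⁻¹)).sum := by
      rw [hfm, derivative_C_mul, eval_mul, eval_mul, mul_assoc, ← h1]
      ring
    have h3 := (hold1 b⁻¹ hb'.le le_rfl).2 i hi
    rw [← neg_neg (rowDeriv _ _ _ _), ← derivative_rowPoly_eval hi, ← eval_rowPoly, ← hf, h2,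
      mul_comm B] at h3
    exact le_of_mul_le_mul_left h3 hfb
  have hm0 : 0 < m.card := by rw [hmcard]; exact Fintype.card_pos
  have hxb : x * (m.card * b - ((m.card : ℝ) - 1) ^ 2 * b ^ 2 / (((m.card : ℝ) - 1) * b + B)) ≤
      m.card := by
    rw [hmcard]
    rcases le_or_gt 0 ((Fintype.card κ : ℝ) * b - ((Fintype.card κ : ℝ) - 1) ^ 2 * b ^ 2 /
      (((Fintype.card κ : ℝ) - 1) * b + B)) with h0 | h0
    · exact (mul_le_mul_of_nonneg_right hx1 h0).trans hy₁b
    · nlinarith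
  have hshift : ∀ a ∈ m, x * ((b - a) + m.sum) ≤ m.card := fun a ha =>
    reciprocal_root_shift_le hm0 hb hB hx0 hxb hm hsum ha
  have hnew : mixed μ (insert i S) Y = c * (1 - x * m.sum / m.card) := by
    have h1 := card_mul_mixed_insert_eq_coeff (μ := μ) hi (Y := Y) (x := x) fun l => rfl
    rw [← hf, hfm, coeff_C_mul, coeff_C_mul, (reciprocalPoly_coeff m).1,
      (reciprocalPoly_coeff m).2] at h1
    rw [hmcard]
    field_simp
    linarith
  have hnewpos : 0 < mixed μ (insert i S) Y := by
    rw [hnew]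
    refine mul_pos hc0 ?_
    obtain ⟨a, ha⟩ := Multiset.card_pos_iff_exists_mem.mp hm0
    have h1 := hshift a ha
    have h2 := (hm a ha).2
    rw [sub_pos, div_lt_one (by exact_mod_cast hm0)]
    rcases hx0.eq_or_lt with h0 | h0
    · rw [← h0, zero_mul]; exact_mod_cast hm0
    · nlinarith
  refine ⟨hnewpos, fun j hj => ?_⟩
  have hji : j ≠ i := by rintro rfl; exact hj (Finset.mem_insert_self j S)
  have hjS : j ∉ S := fun hjS => hj (Finset.mem_insert_of_mem hjS)
  set g : ℝ[X] := rowDeriv μ S (update (fun k l => C (Y k l)) i fun _ => X) j with hg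
  have hrow : ∀ (l : κ) (t : ℝ), rowPoly μ S (update Y j (update (Y j) l t)) i =
      mixed μ S (update (update (fun k l => C (Y k l)) i fun _ => X) j
        (update ((update (fun k l => C (Y k l)) i fun _ => X : ι → κ → ℝ[X]) j) l (C t))) := by
    intro l t
    rw [rowPoly, comp_update₂ (C : ℝ → ℝ[X]), comp_update₁ (C : ℝ → ℝ[X]), update_of_ne hji,
      update_comm hji]
  have hgsum : g = ∑ l, (rowPoly μ S (update Y j (update (Y j) l 0)) i -
      rowPoly μ S (update Y j (update (Y j) l 1)) i) := by
    simp only [hrow, C_0, C_1]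
    rfl
  have hcoeff : (Fintype.card κ : ℝ) * rowDeriv μ (insert i S) Y j =
      Fintype.card κ * g.coeff 0 + x * g.coeff 1 := by
    rw [hgsum, rowDeriv, finsetSum_coeff, finsetSum_coeff, Finset.mul_sum, Finset.mul_sum,
      Finset.mul_sum, ← Finset.sum_add_distrib]
    refine Finset.sum_congr rfl fun l _ => ?_
    have h1 : ∀ t, _ := fun t => card_mul_mixed_insert_eq_coeff (μ := μ) hi
      (Y := update Y j (update (Y j) l t)) (x := x) fun l' => by rw [update_of_ne hji.symm]
    rw [mul_sub, h1, h1, coeff_sub, coeff_sub]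
    ring
  have hgdeg : g.natDegree ≤ m.card := by
    rw [hgsum, hmcard]
    exact natDegree_sum_le_of_forall_le _ _ fun l _ =>
      (natDegree_sub_le_of_le (natDegree_rowPoly_le hi _) (natDegree_rowPoly_le hi _)).trans
        (max_self _).le
  have hNev : NevanlinnaPair g f := by
    refine NevanlinnaPair.finset_sum fun l _ => nevanlinnaPair_mixed hμ.ne_zero hjS (t := y j)
      (fun k l' z hz => ?_) (fun k hk l' l'' => ?_) ?_
    · rcases eq_or_ne k i with rfl | hk
      · simpa using hz.le
      · simp [hk]
    · have hki : k ≠ i := by rintro rfl; exact hi hk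
      simp [hki, hY]
    · simp [hji, hY]
  have hgb : g.eval b⁻¹ ≤ B * f.eval b⁻¹ := by
    have h1 := map_rowDeriv (aeval b⁻¹ : ℝ[X] →ₐ[ℝ] ℝ) μ S
      (update (fun k l => C (Y k l)) i fun _ => X) j
    rw [comp_update₂] at h1
    simp only [coe_aeval_eq_eval, eval_C, eval_X] at h1
    rw [hf, eval_rowPoly, hg, h1]
    exact (hold1 b⁻¹ hb'.le le_rfl).2 j hjS
  rw [hfm] at hNev
  have htr := hNev.truncation_ratio_le (x := x) hc0 hgdeg hm0 hb fun a ha =>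
    ⟨(hm a ha).2, hshift a ha⟩
  rw [← hfm, ← hnew, hmcard] at htr
  have hval : rowDeriv μ (insert i S) Y j = g.coeff 0 + x * g.coeff 1 / Fintype.card κ := by
    field_simp
    linarith
  rw [← hval] at htr
  refine le_of_mul_le_mul_right ?_ hfb
  nlinarith [mul_le_mul_of_nonneg_right hgb hnewpos.le]

end Barrier

section Colouring

open Function

variable {ι κ : Type*} [Fintype ι] [DecidableEq ι] [Fintype κ] [DecidableEq κ]
  {μ : Finset ι → ℝ} {S : Finset ι} {i : ι}

lemma hasBarrier_empty [Nonempty κ] {y₀ y₁ B : ℝ}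
    (h : ∀ d : ι → ℝ, (∀ k, 0 ≤ d k) → (∀ k, d k ≤ y₀) → 0 < multiAffine μ d ∧
      ∀ j, multiAffine μ (update d j 0) - multiAffine μ (update d j 1) ≤ B * multiAffine μ d) :
    HasBarrier κ μ ∅ y₀ y₁ (Fintype.card κ * B) := by
  intro y hy _ hy₀
  obtain ⟨hpos, hder⟩ := h y hy fun k => hy₀ k (by simp)
  have hN : (0 : ℝ) ≤ Fintype.card (ι → κ) := by positivity
  rw [mixed_empty]
  constructor
  · have : (0 : ℝ) < Fintype.card (ι → κ) := by exact_mod_cast Fintype.card_pos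
    exact mul_pos this (Finset.prod_pos fun _ _ => hpos)
  · intro j _
    have hZ : ∀ (l : κ) (t : ℝ), mixed μ ∅ (update (fun k (_ : κ) => y k) j
        (update (fun _ => y j) l t)) = Fintype.card (ι → κ) *
          (multiAffine μ (update y j t) * ∏ l ∈ Finset.univ.erase l, multiAffine μ y) := by
      intro l t
      rw [mixed_empty, ← Finset.mul_prod_erase _ _ (Finset.mem_univ l)]
      congr 2
      · congr 1
        ext k
        rcases eq_or_ne k j with rfl | hk
        · simp
        · simp [hk]
      · refine Finset.prod_congr rfl fun l' hl' => ?_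
        congr 1
        ext k
        rcases eq_or_ne k j with rfl | hk
        · simp [Finset.ne_of_mem_erase hl']
        · simp [hk]
    simp only [rowDeriv, hZ]
    have hle : ∀ l : κ, (Fintype.card (ι → κ) : ℝ) *
          (multiAffine μ (update y j 0) * ∏ l ∈ Finset.univ.erase l, multiAffine μ y) -
        Fintype.card (ι → κ) *
          (multiAffine μ (update y j 1) * ∏ l ∈ Finset.univ.erase l, multiAffine μ y) ≤
        B * (Fintype.card (ι → κ) * ∏ l : κ, multiAffine μ y) := by
      intro l
      rw [← Finset.mul_prod_erase Finset.univ _ (Finset.mem_univ l)]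
      have h1 : 0 ≤ ∏ l ∈ Finset.univ.erase l, multiAffine μ y :=
        Finset.prod_nonneg fun _ _ => hpos.le
      have h2 := mul_le_mul_of_nonneg_left (mul_le_mul_of_nonneg_right (hder j) h1) hN
      linarith
    refine (Finset.sum_le_sum fun l _ => hle l).trans (le_of_eq ?_)
    simp
    ring

/-- A nondecreasing-ratio selection principle: if the average of `G - X * K j` is positive on
`[0, y]`, so is one of these polynomials. -/
lemma exists_pos_of_average_pos {κ : Type*} [Fintype κ] [Nonempty κ] {G : ℝ[X]} {K : κ → ℝ[X]} {y : ℝ} (hy : 0 ≤ y)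
    (hNev : ∀ j, NevanlinnaPair (K j) G) (hG0 : 0 < G.eval 0) (hK0 : ∀ j, 0 ≤ (K j).eval 0)
    (hF : ∀ x ∈ Set.Icc 0 y, 0 < ∑ j, (G.eval x - x * (K j).eval x)) :
    ∃ j, ∀ x ∈ Set.Icc 0 y, 0 < G.eval x - x * (K j).eval x := by
  have hr : (0 : ℝ) < Fintype.card κ := by exact_mod_cast Fintype.card_pos
  -- nonnegativity of `K j` as long as `G` stays positive
  have hK : ∀ x, 0 ≤ x → (∀ s ∈ Set.Icc 0 x, 0 < G.eval s) → ∀ j, 0 ≤ (K j).eval x := by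
    intro x hx hpos j
    have h1 := (hNev j).monotoneOn_div (convex_Icc 0 x) (fun s hs => (hpos s hs).ne')
      (Set.left_mem_Icc.mpr hx) (Set.right_mem_Icc.mpr hx) hx
    have h2 := (div_nonneg (hK0 j) hG0.le).trans h1
    have h3 := mul_nonneg h2 (hpos x (Set.right_mem_Icc.mpr hx)).le
    rwa [div_mul_cancel₀ _ (hpos x (Set.right_mem_Icc.mpr hx)).ne'] at h3
  have hG : ∀ x ∈ Set.Icc 0 y, 0 < G.eval x := by
    by_contra! hcon
    obtain ⟨x₀, hx₀, hGx₀⟩ := hcon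
    let Z : Set ℝ := Set.Icc 0 y ∩ {x | G.eval x ≤ 0}
    have hZc : IsCompact Z := isCompact_Icc.inter_right (isClosed_le G.continuous continuous_const)
    obtain ⟨β, ⟨hβ, hGβ⟩, hmin⟩ := hZc.exists_isLeast ⟨x₀, hx₀, hGx₀⟩
    have hlt : ∀ s, 0 ≤ s → s < β → 0 < G.eval s := fun s hs hsβ => by
      by_contra! h
      exact absurd (hmin ⟨⟨hs, hsβ.le.trans hβ.2⟩, h⟩) (not_le.mpr hsβ)
    have hβ0 : 0 < β := lt_of_le_of_ne hβ.1 fun h => by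
      rw [← h] at hGβ; exact absurd hGβ (not_le.mpr hG0)
    have hle : ∀ s ∈ Set.Ico 0 β, ∑ j, (G.eval s - s * (K j).eval s) ≤
        Fintype.card κ * G.eval s := by
      intro s hs
      rw [← nsmul_eq_mul]
      refine Finset.sum_le_card_nsmul _ _ _ fun j _ => ?_
      have := hK s hs.1 (fun t ht => hlt t ht.1 (ht.2.trans_lt hs.2)) j
      nlinarith [hs.1, mul_nonneg hs.1 this]
    have hlim : ∑ j, (G.eval β - β * (K j).eval β) ≤ Fintype.card κ * G.eval β := by
      have hc1 : Continuous fun s => ∑ j, (G.eval s - s * (K j).eval s) := by fun_prop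
      have hc2 : Continuous fun s => (Fintype.card κ : ℝ) * G.eval s := by fun_prop
      have hcl : IsClosed {s | ∑ j, (G.eval s - s * (K j).eval s) ≤ Fintype.card κ * G.eval s} :=
        isClosed_le hc1 hc2
      have : closure (Set.Ico 0 β) ⊆ _ := hcl.closure_subset_iff.mpr hle
      rw [closure_Ico hβ0.ne] at this
      exact this (Set.right_mem_Icc.mpr hβ0.le)
    have := hF β hβ
    have h4 : (Fintype.card κ : ℝ) * G.eval β ≤ 0 := mul_nonpos_of_nonneg_of_nonpos hr.le hGβ
    linarith
  obtain ⟨j, -, hj⟩ := Finset.exists_lt_of_sum_lt (s := Finset.univ) (f := fun _ : κ => (0 : ℝ))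
    (g := fun j => G.eval y - y * (K j).eval y)
    (by simpa only [Finset.sum_const_zero] using hF y (Set.right_mem_Icc.mpr hy))
  refine ⟨j, fun x hx => ?_⟩
  have hmono := (hNev j).monotoneOn_div (convex_Icc 0 y) (fun s hs => (hG s hs).ne') hx
    (Set.right_mem_Icc.mpr hy) hx.2
  have hGx := hG x hx
  have hGy := hG y (Set.right_mem_Icc.mpr hy)
  have hKy := hK y hy hG j
  have h1 : y * ((K j).eval y / G.eval y) < 1 := by
    rw [← mul_div_assoc, div_lt_one hGy]; linarith
  have h2 : x * ((K j).eval x / G.eval x) ≤ y * ((K j).eval y / G.eval y) :=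
    mul_le_mul hx.2 hmono (div_nonneg (hK x hx.1 (fun s hs => hG s ⟨hs.1, hs.2.trans hx.2⟩) j)
      hGx.le) hy
  have h3 := h2.trans_lt h1
  rw [← mul_div_assoc, div_lt_one hGx] at h3
  linarith

/-- Rows in `S` are averaged over all colours, while row `k ∉ S` has colour `c k`. -/
def partialColouring {R : Type*} [Zero R] (S : Finset ι) (c : ι → κ) (x : R) : ι → κ → R :=
  fun k l => if k ∈ S ∨ c k = l then x else 0

lemma exists_colour_pos [Nonempty κ] (hμ : IsStableFamily μ) (hi : i ∉ S) (c : ι → κ) {y : ℝ}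
    (hy : 0 ≤ y)
    (hc : ∀ x ∈ Set.Icc 0 y, 0 < mixed μ (insert i S) (partialColouring (insert i S) c x)) :
    ∃ j, ∀ x ∈ Set.Icc 0 y, 0 < mixed μ S (partialColouring S (update c i j) x) := by
  obtain ⟨Y, hYdef⟩ : ∃ Y : ι → κ → ℝ[X], Y = partialColouring S c X := ⟨_, rfl⟩
  obtain ⟨G, hG⟩ : ∃ G, G = mixed μ S (update Y i 0) := ⟨_, rfl⟩
  obtain ⟨K, hK⟩ : ∃ K : κ → ℝ[X], ∀ j, K j = G - mixed μ S (update Y i (update 0 j 1)) :=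
    ⟨_, fun _ => rfl⟩
  have hN : (0 : ℝ) < Fintype.card (ι → κ) := by exact_mod_cast Fintype.card_pos
  have hY : ∀ x k l, (Y k l).eval x = partialColouring S c x k l := by
    intro x k l
    simp only [hYdef, partialColouring]
    split_ifs <;> simp
  have heval : ∀ (w : κ → ℝ[X]) (x : ℝ), (mixed μ S (update Y i w)).eval x =
      mixed μ S (update (partialColouring S c x) i fun l => (w l).eval x) := by
    intro w x
    rw [eval_mixed, comp_update₂ (fun p : ℝ[X] => p.eval x)]
    simp only [hY]
  have hzero : ∀ w : κ → ℝ[X], (mixed μ S (update Y i w)).eval 0 =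
      Fintype.card (ι → κ) * ∏ l, (1 - (w l).eval 0 * μ {i}) := by
    intro w
    have h0 : partialColouring S c (0 : ℝ) = 0 := by ext; simp [partialColouring]
    rw [heval, h0, mixed_update_zero hμ.empty hi]
    simp
  have hG0 : G.eval 0 = Fintype.card (ι → κ) := by simp [hG, hzero]
  have hNev : ∀ j, NevanlinnaPair (K j) G := by
    intro j
    have := nevanlinnaPair_mixed hμ.ne_zero hi (Y := update Y i 0) (l := j) (t := 0)
        (fun k l z hz => ?_) (fun k hk l' l'' => ?_) (by simp)
    · simp only [update_idem, update_self] at this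
      rwa [show update (0 : κ → ℝ[X]) j 0 = 0 from update_eq_self j (0 : κ → ℝ[X]), ← hG,
        ← hK] at this
    · rcases eq_or_ne k i with rfl | h
      · simp
      · simp only [update_of_ne h, hYdef, partialColouring]
        split_ifs
        · simpa using hz.le
        · simp
    · have h : k ≠ i := by rintro rfl; exact hi hk
      simp [h, hYdef, partialColouring, hk]
  have hcol : ∀ (j : κ) (x : ℝ), mixed μ S (partialColouring S (update c i j) x) =
      G.eval x - x * (K j).eval x := by
    intro j x
    have h1 : partialColouring S (update c i j) x =
        update (partialColouring S c x) i (update 0 j x) := by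
      ext k l
      rcases eq_or_ne k i with rfl | h
      · rcases eq_or_ne l j with rfl | h'
        · simp [partialColouring]
        · simp [partialColouring, hi, h', h'.symm]
      · simp [partialColouring, h]
    have h2 : update (0 : κ → ℝ) j 0 = 0 := update_eq_self j (0 : κ → ℝ)
    rw [h1, mixed_update_update hi, h2]
    simp only [hK, eval_sub, hG, heval]
    rw [comp_update₁ (fun p : ℝ[X] => p.eval x)]
    simp only [Pi.zero_apply, eval_zero, eval_one]
    change _ = mixed μ S (update (partialColouring S c x) i 0) - x * (mixed μ S (update
      (partialColouring S c x) i 0) - mixed μ S (update (partialColouring S c x) i (update 0 j 1)))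
    ring
  have hK0 : ∀ j, 0 ≤ (K j).eval 0 := by
    intro j
    rw [hK, eval_sub, hG0, hzero, ← Finset.mul_prod_erase _ _ (Finset.mem_univ j),
      Finset.prod_eq_one]
    · have := mul_nonneg hN.le (hμ.singleton_nonneg i)
      rw [update_self, eval_one]
      linarith
    · intro l hl
      simp [Finset.ne_of_mem_erase hl]
  have hF : ∀ x ∈ Set.Icc 0 y, 0 < ∑ j, (G.eval x - x * (K j).eval x) := by
    intro x hx
    have h1 := card_mul_mixed_insert (μ := μ) hi (partialColouring (insert i S) c x)
    have h2 : ∀ j, mixed μ S (update (partialColouring (insert i S) c x) i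
        (update 0 j (partialColouring (insert i S) c x i j))) = G.eval x - x * (K j).eval x := by
      intro j
      rw [← hcol]
      congr 1
      ext k l
      rcases eq_or_ne k i with rfl | h
      · rcases eq_or_ne l j with rfl | h'
        · simp [partialColouring]
        · simp [partialColouring, hi, h', h'.symm]
      · simp [partialColouring, h]
    simp only [h2] at h1
    rw [← h1]
    exact mul_pos (by exact_mod_cast Fintype.card_pos) (hc x hx)
  obtain ⟨j, hj⟩ := exists_pos_of_average_pos hy hNev (by rw [hG0]; exact hN) hK0 hF
  exact ⟨j, fun x hx => by rw [hcol]; exact hj x hx⟩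

lemma exists_colouring_pos [Nonempty κ] (hμ : IsStableFamily μ) {y : ℝ} (hy : 0 ≤ y) :
    ∀ (S : Finset ι) (c : ι → κ), (∀ x ∈ Set.Icc 0 y, 0 < mixed μ S (partialColouring S c x)) →
      ∃ c' : ι → κ, ∀ x ∈ Set.Icc 0 y, 0 < mixed μ ∅ (partialColouring ∅ c' x) := by
  intro S
  induction S using Finset.induction_on with
  | empty => exact fun c h => ⟨c, h⟩
  | insert i S hi ih =>
    intro c hc
    obtain ⟨j, hj⟩ := exists_colour_pos hμ hi c hy hc
    exact ih _ hj

/-- The abstract paving theorem. -/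
theorem exists_colouring_multiAffine_ne_zero [Nonempty κ] (hμ : IsStableFamily μ) {b y₁ B : ℝ}
    (hb : 0 < b) (hB : 0 < B) (hy₁ : 0 ≤ y₁)
    (hy₁b : y₁ * (Fintype.card κ * b - ((Fintype.card κ : ℝ) - 1) ^ 2 * b ^ 2 /
      (((Fintype.card κ : ℝ) - 1) * b + Fintype.card κ * B)) ≤ Fintype.card κ)
    (h : ∀ d : ι → ℝ, (∀ k, 0 ≤ d k) → (∀ k, d k ≤ b⁻¹) → 0 < multiAffine μ d ∧
      ∀ j, multiAffine μ (update d j 0) - multiAffine μ (update d j 1) ≤ B * multiAffine μ d) :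
    ∃ c : ι → κ, ∀ x ∈ Set.Icc 0 y₁, ∀ l,
      multiAffine μ (fun k => if c k = l then x else 0) ≠ 0 := by
  have hr : (0 : ℝ) < Fintype.card κ := by exact_mod_cast Fintype.card_pos
  have hbar : ∀ S, HasBarrier κ μ S b⁻¹ y₁ (Fintype.card κ * B) := by
    intro S
    induction S using Finset.induction_on with
    | empty => exact hasBarrier_empty h
    | insert i S hi ih => exact hasBarrier_insert hμ hi hb (by positivity) hy₁b ih
  obtain ⟨l₀⟩ := ‹Nonempty κ›
  have : Nonempty κ := ⟨l₀⟩
  obtain ⟨c, hc⟩ := exists_colouring_pos hμ hy₁ Finset.univ (fun _ => l₀) fun x hx => by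
    have := (hbar Finset.univ (fun _ => x) (fun _ => hx.1) (fun _ _ => hx.2) (by simp)).1
    have h1 : partialColouring Finset.univ (fun _ : ι => l₀) x = fun _ _ => x := by
      ext; simp [partialColouring]
    rwa [h1]
  refine ⟨c, fun x hx l h0 => (hc x hx).ne' ?_⟩
  rw [mixed_empty]
  refine mul_eq_zero_of_right _ (Finset.prod_eq_zero (Finset.mem_univ l) ?_)
  simpa [partialColouring] using h0

end Colouring

section PrincipalMinors

open Function Matrix
open scoped Matrix.Norms.L2Operator MatrixOrder

variable {ι : Type*} [Fintype ι] {A : Matrix ι ι ℂ}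

lemma star_dotProduct_mulVec_of_eq (hA : A.IsHermitian) {d v : ι → ℂ}
    (h : ∀ k, v k = d k * (A *ᵥ v) k) :
    star v ⬝ᵥ A *ᵥ v = ∑ k, d k * ((‖(A *ᵥ v) k‖ ^ 2 : ℝ) : ℂ) := by
  have h1 : star v ⬝ᵥ A *ᵥ v = star (A *ᵥ v) ⬝ᵥ v := by
    rw [star_mulVec, hA.eq, dotProduct_mulVec]
  rw [h1, dotProduct]
  refine Finset.sum_congr rfl fun k _ => ?_
  rw [Complex.ofReal_pow, ← Complex.mul_conj', ← mul_assoc, ← h k, mul_comm]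
  rfl

variable [DecidableEq ι]

/-- The principal minors of `A`. -/
noncomputable def principalMinor (A : Matrix ι ι ℂ) (s : Finset ι) : ℝ :=
  (det (of (s.piecewise A.row (1 : Matrix ι ι ℂ).row))).re

lemma ofReal_principalMinor (hA : A.IsHermitian) (s : Finset ι) :
    (principalMinor A s : ℂ) = det (of (s.piecewise A.row (1 : Matrix ι ι ℂ).row)) := by
  set E : Matrix ι ι ℂ := diagonal fun k => if k ∈ s then 1 else 0 with hE
  have h1 : of (s.piecewise A.row (1 : Matrix ι ι ℂ).row) = 1 - E * (1 - A) := by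
    ext i j
    by_cases h : i ∈ s <;> simp [hE, h, Matrix.row, Finset.piecewise]
  have h2 : (1 - E * (1 - A))ᴴ = 1 - (1 - A) * E := by
    have : Eᴴ = E := by
      rw [hE, diagonal_conjTranspose]
      congr 1
      ext k
      by_cases h : k ∈ s <;> simp [h]
    simp [conjTranspose_mul, this, hA.eq]
  rw [principalMinor, h1, ← Complex.conj_eq_iff_re]
  change star _ = _
  rw [← det_conjTranspose, h2, det_one_sub_mul_comm]

lemma multiAffine_principalMinor (hA : A.IsHermitian) (d : ι → ℂ) :
    multiAffine (principalMinor A) d = det (1 - diagonal d * A) := by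
  have h1 : 1 - diagonal d * A = of ((fun k => -d k • A.row k) + (1 : Matrix ι ι ℂ).row) := by
    ext i j
    rw [Matrix.sub_apply, diagonal_mul, of_apply, Pi.add_apply, Pi.add_apply, Pi.smul_apply, neg_smul,
      smul_eq_mul, sub_eq_neg_add]
    rfl
  have h2 := (detRowAlternating (n := ι) (R := ℂ)).toMultilinearMap.map_add_univ
    (fun k => -d k • A.row k) (1 : Matrix ι ι ℂ).row
  rw [h1]
  refine Eq.trans ?_ h2.symm
  refine Finset.sum_congr rfl fun s _ => ?_
  have h3 : s.piecewise (fun k => -d k • A.row k) (1 : Matrix ι ι ℂ).row =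
      s.piecewise (fun k => -d k • s.piecewise A.row (1 : Matrix ι ι ℂ).row k)
        (s.piecewise A.row (1 : Matrix ι ι ℂ).row) := by
    ext i j
    by_cases h : i ∈ s <;> simp [h]
  rw [h3, MultilinearMap.map_piecewise_smul, smul_eq_mul, mul_comm]
  congr 1
  exact ofReal_principalMinor hA s

lemma ofReal_multiAffine_principalMinor (hA : A.IsHermitian) (d : ι → ℝ) :
    ((multiAffine (principalMinor A) d : ℝ) : ℂ) = det (1 - diagonal (fun k => (d k : ℂ)) * A) := by
  rw [← multiAffine_principalMinor hA]
  exact map_multiAffine Complex.ofRealAm _ _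

lemma exists_mulVec_of_det_eq_zero {d : ι → ℂ} (h : det (1 - diagonal d * A) = 0) :
    ∃ v ≠ 0, ∀ k, v k = d k * (A *ᵥ v) k := by
  obtain ⟨v, hv, hv'⟩ := exists_mulVec_eq_zero_iff.2 h
  refine ⟨v, hv, fun k => ?_⟩
  have := congrFun hv' k
  rw [sub_mulVec, one_mulVec, ← mulVec_mulVec, Pi.sub_apply, mulVec_diagonal] at this
  exact sub_eq_zero.1 this

lemma isStableFamily_principalMinor (hA : A.PosSemidef) : IsStableFamily (principalMinor A) where
  ne_zero d hd h := by
    rw [multiAffine_principalMinor hA.isHermitian] at h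
    obtain ⟨v, hv, hv'⟩ := exists_mulVec_of_det_eq_zero h
    have h1 := congrArg Complex.im (star_dotProduct_mulVec_of_eq hA.isHermitian hv')
    rw [← (Complex.le_def.1 (hA.dotProduct_mulVec_nonneg v)).2, Complex.im_sum] at h1
    simp only [Complex.zero_im, Complex.im_mul_ofReal] at h1
    have hd' : ∀ k, 0 ≤ (d k).im := fun k => by
      rcases hd k with h | h
      · simp [h]
      · exact h.le
    have h2 := (Finset.sum_eq_zero_iff_of_nonneg fun k _ =>
      mul_nonneg (hd' k) (sq_nonneg ‖(A *ᵥ v) k‖)).1 h1.symm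
    refine hv (funext fun k => ?_)
    rw [hv' k]
    rcases hd k with h | h
    · simp [h]
    · simpa [h.ne'] using Or.inr (h2 k (Finset.mem_univ k))
  empty := by simp [principalMinor, Matrix.row]; exact congrArg Complex.re det_one
  singleton_nonneg i := by
    have h1 : of (Finset.piecewise {i} A.row (1 : Matrix ι ι ℂ).row) = updateRow 1 i (A.row i) := by
      ext k l
      rcases eq_or_ne k i with rfl | h <;> simp [Matrix.row, Finset.piecewise, *]
    have h2 : 0 ≤ A i i := hA.diag_nonneg
    rw [principalMinor, h1, ← cramer_transpose_apply, transpose_one, cramer_one]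
    exact (Complex.le_def.1 h2).1

lemma exists_quadratic_bounds (hA : A.PosSemidef) (hnorm : ‖A‖ ≤ 1) (v : ι → ℂ) :
    ∃ q : ℝ, star v ⬝ᵥ A *ᵥ v = q ∧ ∑ k, ‖(A *ᵥ v) k‖ ^ 2 ≤ q ∧
      ∀ j, ‖(A *ᵥ v) j‖ ^ 2 ≤ (A j j).re * q := by
  obtain ⟨M, rfl⟩ := CStarAlgebra.nonneg_iff_eq_star_mul_self.1 hA.nonneg
  rw [star_eq_conjTranspose] at *
  refine ⟨∑ k, ‖(M *ᵥ v) k‖ ^ 2, ?_, ?_, fun j => ?_⟩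
  · rw [← mulVec_mulVec, dotProduct_mulVec, ← star_mulVec, dotProduct, Complex.ofReal_sum]
    refine Finset.sum_congr rfl fun k _ => ?_
    rw [Complex.ofReal_pow, ← Complex.conj_mul']
    rfl
  · rw [l2_opNorm_conjTranspose_mul_self, ← l2_opNorm_conjTranspose] at hnorm
    have hM : ‖Mᴴ‖ ≤ 1 := by nlinarith [norm_nonneg Mᴴ]
    have h1 := (l2_opNorm_mulVec Mᴴ (WithLp.toLp 2 (M *ᵥ v))).trans
      (mul_le_of_le_one_left (norm_nonneg _) hM)
    have h2 := pow_le_pow_left₀ (norm_nonneg _) h1 2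
    rw [EuclideanSpace.norm_sq_eq, EuclideanSpace.norm_sq_eq] at h2
    rw [← mulVec_mulVec]
    exact h2
  · have h1 : ‖((Mᴴ * M) *ᵥ v) j‖ ≤ ∑ k, ‖M k j‖ * ‖(M *ᵥ v) k‖ := by
      rw [← mulVec_mulVec, mulVec, dotProduct]
      refine (norm_sum_le _ _).trans_eq (Finset.sum_congr rfl fun k _ => ?_)
      simp
    have h2 : ((Mᴴ * M) j j).re = ∑ k, ‖M k j‖ ^ 2 := by
      rw [mul_apply, Complex.re_sum]
      refine Finset.sum_congr rfl fun k _ => ?_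
      rw [conjTranspose_apply, RCLike.star_def, Complex.conj_mul', ← Complex.ofReal_pow,
        Complex.ofReal_re]
    rw [h2]
    exact (pow_le_pow_left₀ (norm_nonneg _) h1 2).trans (Finset.sum_mul_sq_le_sq_mul_sq _ _ _)

lemma exists_weights_of_multiAffine_eq_zero (hA : A.PosSemidef) (hnorm : ‖A‖ ≤ 1) {d : ι → ℝ}
    (h : multiAffine (principalMinor A) d = 0) :
    ∃ w : ι → ℝ, (∀ k, 0 ≤ w k) ∧ 0 < ∑ k, w k ∧ ∑ k, w k ≤ ∑ k, d k * w k ∧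
      ∀ j, w j ≤ (A j j).re * ∑ k, d k * w k := by
  have h' := ofReal_multiAffine_principalMinor hA.isHermitian d
  rw [h, Complex.ofReal_zero] at h'
  obtain ⟨v, hv, hv'⟩ := exists_mulVec_of_det_eq_zero h'.symm
  obtain ⟨q, hq, hq1, hq2⟩ := exists_quadratic_bounds hA hnorm v
  have h1 := star_dotProduct_mulVec_of_eq hA.isHermitian hv'
  rw [hq] at h1
  have h2 : q = ∑ k, d k * ‖(A *ᵥ v) k‖ ^ 2 := by exact_mod_cast h1
  refine ⟨fun k => ‖(A *ᵥ v) k‖ ^ 2, fun k => sq_nonneg _, ?_, h2 ▸ hq1, h2 ▸ hq2⟩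
  obtain ⟨k, hk⟩ := Function.ne_iff.1 hv
  refine Finset.sum_pos' (fun k _ => sq_nonneg _) ⟨k, Finset.mem_univ k, ?_⟩
  have : (A *ᵥ v) k ≠ 0 := fun h0 => hk (by rw [hv' k, h0, mul_zero]; rfl)
  positivity

lemma multiAffine_principalMinor_pos (hA : A.PosSemidef) (hnorm : ‖A‖ ≤ 1) {y₀ : ℝ} (hy₀ : 0 ≤ y₀)
    (hy₀1 : y₀ < 1) {d : ι → ℝ} (hd : ∀ k, d k ≤ y₀) : 0 < multiAffine (principalMinor A) d := by
  by_contra! hle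
  have hc : ContinuousOn (fun t : ℝ => multiAffine (principalMinor A) fun k => t * d k)
      (Set.Icc 0 1) := by
    unfold multiAffine
    fun_prop
  have h0 : multiAffine (principalMinor A) (fun k => 0 * d k) = 1 := by
    rw [← Complex.ofReal_inj, ofReal_multiAffine_principalMinor hA.isHermitian]
    simp
  obtain ⟨t, ht, ht0⟩ := intermediate_value_Icc' zero_le_one hc
    ⟨by simpa only [one_mul] using hle, h0.symm ▸ zero_le_one⟩
  obtain ⟨w, hw, hw0, hw1, -⟩ := exists_weights_of_multiAffine_eq_zero hA hnorm ht0
  have h1 : ∑ k, t * d k * w k ≤ ∑ k, y₀ * w k := by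
    refine Finset.sum_le_sum fun k _ => mul_le_mul_of_nonneg_right ?_ (hw k)
    nlinarith [mul_le_mul_of_nonneg_left (hd k) ht.1, mul_le_of_le_one_left hy₀ ht.2]
  rw [← Finset.mul_sum] at h1
  nlinarith

lemma multiAffine_principalMinor_sub_le (hA : A.PosSemidef) (hnorm : ‖A‖ ≤ 1) {α : ℝ}
    (hα : 0 < α) (hdiag : ∀ i, (A i i).re ≤ α) {y₀ : ℝ} (hy₀ : 0 ≤ y₀)
    (hy₀1 : y₀ < 1) {d : ι → ℝ} (hd : ∀ k, d k ≤ y₀) (j : ι) :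
    multiAffine (principalMinor A) (update d j 0) - multiAffine (principalMinor A) (update d j 1) ≤
      α / (1 - y₀) * multiAffine (principalMinor A) d := by
  have hpos := multiAffine_principalMinor_pos hA hnorm hy₀ hy₀1 hd
  by_contra! hlt
  set D := multiAffine (principalMinor A) (update d j 0) -
    multiAffine (principalMinor A) (update d j 1) with hD
  have h1y : 0 < 1 - y₀ := sub_pos.2 hy₀1
  have hD0 : 0 < D := lt_trans (by positivity) hlt
  set s := multiAffine (principalMinor A) d / D with hs
  have hs0 : 0 < s := by positivity
  have hs1 : s * α < 1 - y₀ := by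
    rw [div_mul_eq_mul_div, div_lt_iff₀ h1y] at hlt
    rw [hs, div_mul_eq_mul_div, div_lt_iff₀ hD0]
    linarith
  have hzero : multiAffine (principalMinor A) (update d j (d j + s)) = 0 := by
    have h2 := multiAffine_update (principalMinor A) d j (d j)
    have h3 : s * D = multiAffine (principalMinor A) d := div_mul_cancel₀ _ hD0.ne'
    rw [update_eq_self] at h2
    rw [multiAffine_update]
    linear_combination -h2 - h3 + s * hD
  obtain ⟨w, hw, hw0, hw1, hw2⟩ := exists_weights_of_multiAffine_eq_zero hA hnorm hzero
  set Q := ∑ k, update d j (d j + s) k * w k with hQ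
  have h2 : Q = ∑ k, d k * w k + s * w j := by
    have h3 : ∀ k, update d j (d j + s) k = d k + (if k = j then s else 0) := fun k => by
      rcases eq_or_ne k j with rfl | hk <;> simp [*]
    simp only [hQ, h3, add_mul, Finset.sum_add_distrib, ite_mul, zero_mul, Finset.sum_ite_eq',
      Finset.mem_univ, if_true]
  have h3 : ∑ k, d k * w k ≤ y₀ * ∑ k, w k := by
    rw [Finset.mul_sum]
    exact Finset.sum_le_sum fun k _ => mul_le_mul_of_nonneg_right (hd k) (hw k)
  have hQ0 : 0 < Q := hw0.trans_le hw1
  have h4 : w j ≤ α * Q := (hw2 j).trans (mul_le_mul_of_nonneg_right (hdiag j) hQ0.le)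
  have h5 := mul_le_mul_of_nonneg_left h4 hs0.le
  have h6 := mul_le_mul_of_nonneg_left hw1 hy₀
  have h7 := mul_lt_mul_of_pos_right hs1 hQ0
  linarith

lemma norm_compression_le (hA : A.PosSemidef) {β : ℝ} (hβ : 0 < β) (p : ι → Prop) [DecidablePred p]
    (h : ∀ x ∈ Set.Icc 0 β⁻¹, multiAffine (principalMinor A) (fun k => if p k then x else 0) ≠ 0) :
    ‖diagonal (fun k => if p k then 1 else 0) * A * diagonal (fun k => if p k then 1 else 0)‖ ≤
      β := by
  set E : Matrix ι ι ℂ := diagonal fun k => if p k then 1 else 0 with hE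
  rcases isEmpty_or_nonempty ι with hι | hι
  · rw [Subsingleton.elim (E * A * E) 0, norm_zero]
    exact hβ.le
  have hEE : E * E = E := by simp [hE]
  have hEs : Eᴴ = E := by
    rw [hE, diagonal_conjTranspose]
    congr 1
    ext k
    by_cases hk : p k <;> simp [hk]
  by_contra! hlt
  set x := ‖E * A * E‖⁻¹ with hx
  have hpos : 0 < ‖E * A * E‖ := hβ.trans hlt
  have hnn : 0 ≤ E * A * E := by
    have := hA.conjTranspose_mul_mul_same E
    rw [hEs] at this
    exact this.nonneg
  refine h x ⟨inv_nonneg.2 hpos.le, inv_anti₀ hβ hlt.le⟩ ?_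
  have hmem := CStarAlgebra.norm_mem_spectrum_of_nonneg hnn
  rw [spectrum.mem_iff, isUnit_iff_isUnit_det, isUnit_iff_ne_zero, not_not] at hmem
  have h1 : diagonal (fun k => ((if p k then x else 0 : ℝ) : ℂ)) = (x : ℂ) • E := by
    ext i j
    by_cases hk : p i <;> simp [hE, hk, diagonal_apply]
  have h2 : 1 - ((x : ℂ) • (E * A)) * E =
      (x : ℂ) • (algebraMap ℝ (Matrix ι ι ℂ) ‖E * A * E‖ - E * A * E) := by
    have h3 : (x : ℂ) • algebraMap ℝ (Matrix ι ι ℂ) ‖E * A * E‖ = 1 := by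
      rw [Algebra.algebraMap_eq_smul_one, ← Complex.coe_smul, smul_smul, ← Complex.ofReal_mul, hx,
        inv_mul_cancel₀ hpos.ne', Complex.ofReal_one, one_smul]
    rw [smul_sub, h3, smul_mul_assoc]
  have h4 : (x : ℂ) • E * A = E * ((x : ℂ) • (E * A)) := by
    rw [mul_smul_comm, ← mul_assoc, hEE, smul_mul_assoc]
  rw [← Complex.ofReal_inj, ofReal_multiAffine_principalMinor hA.isHermitian, h1, h4,
    det_one_sub_mul_comm, h2, det_smul, hmem, mul_zero, Complex.ofReal_zero]

lemma exists_colouring_norm_le {κ : Type*} [Fintype κ] [DecidableEq κ] (hκ : 2 ≤ Fintype.card κ)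
    (hA : A.PosSemidef) (hnorm : ‖A‖ ≤ 1) {a e : ℝ} (ha : 0 < a) (he : 0 < e)
    (hdiag : ∀ i, (A i i).re ≤ a ^ 2) (hae : a < (Fintype.card κ - 1) * e)
    (h : Fintype.card κ * ((Fintype.card κ - 1) * e ^ 2 + a ^ 2) = (Fintype.card κ : ℝ) - 1) :
    ∃ c : ι → κ, ∀ l, ‖diagonal (fun k => if c k = l then 1 else 0) * A *
      diagonal (fun k => if c k = l then 1 else 0)‖ ≤ (e + a) ^ 2 := by
  have : Nonempty κ := Fintype.card_pos_iff.1 (by lia)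
  have hr : (2 : ℝ) ≤ Fintype.card κ := by exact_mod_cast hκ
  obtain ⟨m, hm⟩ : ∃ m : ℝ, (Fintype.card κ : ℝ) = m + 1 := ⟨_, (sub_add_cancel _ 1).symm⟩
  simp only [hm, add_sub_cancel_right] at h hae
  have hm1 : 1 ≤ m := by linarith
  set g := m * e - a with hg
  have hg0 : 0 < g := sub_pos.2 hae
  set b := (m + 1) * e * (a + e) with hb
  have hb1 : b - 1 = (m + 1) * a * g / m := by
    field_simp
    rw [hb, hg]
    linear_combination h
  have hb1' : 0 < b - 1 := by rw [hb1]; positivity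
  have hb0 : 0 < b := by linarith
  have hB : a ^ 2 / (1 - b⁻¹) = a * b * m / ((m + 1) * g) := by
    have h1 : 1 - b⁻¹ = (m + 1) * a * g / m / b := by
      rw [← hb1]
      field_simp
    rw [h1]
    field_simp
  have hbi : b⁻¹ < 1 := inv_lt_one_of_one_lt₀ (by linarith)
  obtain ⟨c, hc⟩ := exists_colouring_multiAffine_ne_zero (κ := κ) (isStableFamily_principalMinor hA)
    hb0 (B := a ^ 2 / (1 - b⁻¹)) (y₁ := ((e + a) ^ 2)⁻¹) (by rw [hB]; positivity) (by positivity)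
    (by
      have h1 : m * b + (m + 1) * (a * b * m / ((m + 1) * g)) = m ^ 2 * b * e / g := by
        field_simp
        rw [hg]
        ring
      simp only [hm, add_sub_cancel_right, hB, h1]
      have h2 : m ^ 2 * b ^ 2 / (m ^ 2 * b * e / g) = (m + 1) * (a + e) * g := by
        rw [div_div_eq_mul_div, div_eq_iff (by positivity), hb]
        ring
      rw [h2, inv_mul_le_iff₀ (by positivity), hb, hg]
      exact le_of_eq (by ring))
    fun d _ hd => ⟨multiAffine_principalMinor_pos hA hnorm (by positivity) hbi hd,
      multiAffine_principalMinor_sub_le hA hnorm (by positivity) hdiag (by positivity) hbi hd⟩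
  exact ⟨c, fun l => norm_compression_le hA (by positivity) _ fun x hx => hc x hx l⟩

end PrincipalMinors

end Colourings

open scoped Matrix.Norms.L2Operator in
lemma opNorm_eq_norm {n : ℕ} (A : Matrix (Fin n) (Fin n) ℂ) : opNorm A = ‖A‖ :=
  (Matrix.cstar_norm_def A).symm

lemma isDiagonalProjection_ite {n : ℕ} (p : Fin n → Prop) [DecidablePred p] :
    IsDiagonalProjection (Matrix.diagonal fun k => if p k then 1 else 0) :=
  ⟨_, rfl, fun k => by by_cases h : p k <;> simp [h]⟩

lemma sum_diagonal_ite {n r : ℕ} (c : Fin n → Fin r) :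
    ∑ i, (Matrix.diagonal fun k => if c k = i then 1 else 0 : Matrix (Fin n) (Fin n) ℂ) = 1 := by
  ext k l
  rw [Matrix.sum_apply]
  rcases eq_or_ne k l with rfl | h
  · simp
  · simp [h]

theorem stmt0 (r : ℕ) (hr : 2 ≤ r) (α : ℝ) (hα0 : 0 < α)
    (hα1 : α ≤ ((r : ℝ) - 1) ^ 2 / (r : ℝ) ^ 2)
    (n : ℕ) (A : Matrix (Fin n) (Fin n) ℂ)
    (hA : A.PosSemidef) (hAnorm : opNorm A ≤ 1)
    (hdiag : ∀ i, (A i i).re ≤ α) :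
    ∃ P : Fin r → Matrix (Fin n) (Fin n) ℂ,
      (∀ i, IsDiagonalProjection (P i)) ∧ (∑ i, P i) = 1 ∧
      ∀ i, opNorm (P i * A * P i) ≤
        (Real.sqrt (1 / (r : ℝ) - α / ((r : ℝ) - 1)) + Real.sqrt α) ^ 2 := by
  obtain ⟨m, hm⟩ : ∃ m : ℝ, (r : ℝ) = m + 1 := ⟨_, (sub_add_cancel _ 1).symm⟩
  have hm1 : 1 ≤ m := by
    have : (2 : ℝ) ≤ r := by exact_mod_cast hr
    linarith
  have hm0 : 0 < m := by linarith
  simp only [hm, add_sub_cancel_right] at hα1 ⊢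
  have hα1' : α * (m + 1) ^ 2 ≤ m ^ 2 := (le_div_iff₀ (by positivity)).1 hα1
  have key : 1 / (m + 1) - α / m = (m - α * (m + 1)) / (m * (m + 1)) := by
    field_simp
  suffices h : ∃ c : Fin n → Fin r, ∀ i,
      opNorm ((Matrix.diagonal fun k => if c k = i then 1 else 0) * A *
        Matrix.diagonal fun k => if c k = i then 1 else 0) ≤
      (√(1 / (m + 1) - α / m) + √α) ^ 2 by
    obtain ⟨c, hc⟩ := h
    exact ⟨_, fun i => isDiagonalProjection_ite _, sum_diagonal_ite c, hc⟩
  have hroot : 1 / (m + 1) ^ 2 ≤ 1 / (m + 1) - α / m := by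
    rw [key, div_le_div_iff₀ (by positivity) (by positivity)]
    nlinarith
  have hsq : √(1 / (m + 1) - α / m) ^ 2 = 1 / (m + 1) - α / m :=
    Real.sq_sqrt (le_trans (by positivity) hroot)
  rcases hα1'.eq_or_lt with heq | hlt
  · have h1 : √α = m / (m + 1) := by
      rw [Real.sqrt_eq_iff_mul_self_eq hα0.le (by positivity)]
      field_simp
      linarith
    have h2 : √(1 / (m + 1) - α / m) = 1 / (m + 1) := by
      rw [Real.sqrt_eq_iff_mul_self_eq (le_trans (by positivity) hroot) (by positivity)]
      field_simp
      nlinarith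
    have h3 : (√(1 / (m + 1) - α / m) + √α) ^ 2 = 1 := by
      rw [h1, h2, ← add_div, add_comm, div_self (by positivity), one_pow]
    rw [h3]
    have : NeZero r := ⟨by lia⟩
    refine ⟨fun _ => 0, fun i => ?_⟩
    by_cases hi : 0 = i
    · simpa [hi] using hAnorm
    · simp [hi, opNorm]
  · have h1 : 0 < √(1 / (m + 1) - α / m) := Real.sqrt_pos.2 (lt_of_lt_of_le (by positivity) hroot)
    have h2 : √α < m / (m + 1) := by
      rw [Real.sqrt_lt' (by positivity), div_pow, lt_div_iff₀ (by positivity)]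
      exact hlt
    have h3 : 1 / (m + 1) ≤ √(1 / (m + 1) - α / m) := by
      rw [Real.le_sqrt' (by positivity), div_pow, one_pow]
      exact hroot
    simp only [opNorm_eq_norm] at hAnorm ⊢
    refine exists_colouring_norm_le (by simpa using hr) hA hAnorm (Real.sqrt_pos.2 hα0) h1 ?_ ?_ ?_
    · simpa only [Real.sq_sqrt hα0.le] using hdiag
    · simp only [Fintype.card_fin, hm, add_sub_cancel_right]
      refine h2.trans_le ?_
      rw [← mul_one_div]
      exact mul_le_mul_of_nonneg_left h3 hm0.le
    · simp only [Fintype.card_fin, hm, add_sub_cancel_right, hsq, Real.sq_sqrt hα0.le]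
      field_simp
      ring
end

section
/- Let 𝔛 be a strongly Rayleigh point process on [n] with 0 < ℙ(n ∈ 𝔛) < 1, and let g be its kernel polynomial. Let g_1 and g_0 be the kernel polynomials of the point processes (𝔛 ∩ [n−1] | n ∈ 𝔛) and (𝔛 ∩ [n−1] | n ∉ 𝔛), respectively. Then the diagonalization ḡ_1 is in proper position with respect to ḡ, and the diagonalization ḡ_0 is in proper position with respect to ḡ. -/
open MvPolynomial Polynomial

/-- A polynomial with real coefficients is *real stable* if it does not vanish
when all variables have positive imaginary part. -/
def RealStable {n : ℕ} (p : MvPolynomial (Fin n) ℝ) : Prop :=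
  ∀ z : Fin n → ℂ, (∀ i, 0 < (z i).im) →
    MvPolynomial.eval z (MvPolynomial.map (algebraMap ℝ ℂ) p) ≠ 0

/-- A polynomial is *multi-affine* if it has degree at most 1 in each variable. -/
def MultiAffine {n : ℕ} (p : MvPolynomial (Fin n) ℝ) : Prop :=
  ∀ i, p.degreeOf i ≤ 1

/-- The diagonalization `p̄(x) = p(x,…,x)` of a multivariate polynomial. -/
noncomputable def diagPoly {n : ℕ} (p : MvPolynomial (Fin n) ℝ) : Polynomial ℝ :=
  MvPolynomial.aeval (fun _ => Polynomial.X) p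

/-- The exponent of the multi-affine monomial `∏_{i ∈ A} z_i`. -/
noncomputable def expOf {n : ℕ} (A : Finset (Fin n)) : Fin n →₀ ℕ :=
  ∑ i ∈ A, Finsupp.single i 1

/-- `∂^S p = (∏_{i ∈ S} ∂/∂z_i) p`. -/
noncomputable def pderivs {n : ℕ} (S : Finset (Fin n)) (p : MvPolynomial (Fin n) ℝ) :
    MvPolynomial (Fin n) ℝ :=
  S.toList.foldr (fun i q => MvPolynomial.pderiv i q) p

/-- `μ` is the law of a point process on `[n]`, i.e. a probability
distribution on subsets of `[n]`. -/
def IsPointProcess {n : ℕ} (μ : Finset (Fin n) → ℝ) : Prop :=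
  (∀ A, 0 ≤ μ A) ∧ (∑ A : Finset (Fin n), μ A) = 1

/-- The probability generating polynomial `f_𝔛(z) = Σ_A ℙ(𝔛 = A) z^A`. -/
noncomputable def genPoly {n : ℕ} (μ : Finset (Fin n) → ℝ) : MvPolynomial (Fin n) ℝ :=
  ∑ A : Finset (Fin n), MvPolynomial.monomial (expOf A) (μ A)

/-- A point process is strongly Rayleigh if its probability generating
polynomial is real stable. -/
def StronglyRayleigh {n : ℕ} (μ : Finset (Fin n) → ℝ) : Prop :=
  IsPointProcess μ ∧ RealStable (genPoly μ)

/-- `ℙ(A ⊆ 𝔛)`. -/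
noncomputable def probSupset {n : ℕ} (μ : Finset (Fin n) → ℝ) (A : Finset (Fin n)) : ℝ :=
  ∑ B ∈ Finset.univ.filter (fun B : Finset (Fin n) => A ⊆ B), μ B

/-- The kernel polynomial `g_𝔛(z) = Σ_A (−1)^{|A|} ℙ(A ⊆ 𝔛) z^{A^c}`. -/
noncomputable def kernelPoly {n : ℕ} (μ : Finset (Fin n) → ℝ) : MvPolynomial (Fin n) ℝ :=
  ∑ A : Finset (Fin n),
    MvPolynomial.monomial (expOf Aᶜ) ((-1 : ℝ) ^ A.card * probSupset μ A)

/-- `p_j = ℙ(j ∈ 𝔛)`. -/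
noncomputable def probMem {n : ℕ} (μ : Finset (Fin n) → ℝ) (j : Fin n) : ℝ :=
  ∑ A ∈ Finset.univ.filter (fun A : Finset (Fin n) => j ∈ A), μ A

/-- Law of the conditioned process `(𝔛 ∩ [n−1] | n ∈ 𝔛)`. -/
noncomputable def condIn {n : ℕ} (μ : Finset (Fin (n + 1)) → ℝ) :
    Finset (Fin n) → ℝ :=
  fun B => μ (insert (Fin.last n) (B.map Fin.castSuccEmb)) / probMem μ (Fin.last n)

/-- Law of the conditioned process `(𝔛 ∩ [n−1] | n ∉ 𝔛)`. -/
noncomputable def condOut {n : ℕ} (μ : Finset (Fin (n + 1)) → ℝ) :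
    Finset (Fin n) → ℝ :=
  fun B => μ (B.map Fin.castSuccEmb) / (1 - probMem μ (Fin.last n))

/-- Alternation `a₁ ≥ b₁ ≥ a₂ ≥ b₂ ≥ …` of two non-increasing lists, the first
list starting; the lengths are forced to differ by at most one. -/
def StartsGE : List ℝ → List ℝ → Prop
  | [], m => m = []
  | _ :: as, [] => as = []
  | a :: as, b :: bs => b ≤ a ∧ StartsGE (b :: bs) as
termination_by l m => l.length + m.length

/-- The real roots of `p` (with multiplicity), sorted in non-increasing order. -/
noncomputable def descRoots (p : Polynomial ℝ) : List ℝ :=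
  (p.roots.sort (· ≤ ·)).reverse

/-- The roots of `p` and `q` interlace (alternate). -/
def RootsInterlace (p q : Polynomial ℝ) : Prop :=
  StartsGE (descRoots p) (descRoots q) ∨ StartsGE (descRoots q) (descRoots p)

/-- `q` is in proper position with respect to `p` (`q ≪ p`): the roots of `q`
and `p` interlace and the Wronskian `W[p,q] = pq′ − p′q` is non-positive on ℝ. -/
def ProperPosition (q p : Polynomial ℝ) : Prop :=
  RootsInterlace p q ∧
  ∀ x : ℝ, Polynomial.eval x p * Polynomial.eval x (Polynomial.derivative q) -
    Polynomial.eval x (Polynomial.derivative p) * Polynomial.eval x q ≤ 0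

theorem startsGE_orderedInsert (r : ℝ) (l m : List ℝ) (h : StartsGE l m) :
    StartsGE (l.orderedInsert (· ≥ ·) r) (m.orderedInsert (· ≥ ·) r) := by
  match l, m with
  | [], m =>
    rw [StartsGE] at h
    subst h
    simp [StartsGE]
  | a :: as, [] =>
    rw [StartsGE] at h
    subst h
    by_cases hr : a ≤ r
    · simp [hr, StartsGE]
    · simp [hr, StartsGE, (not_le.mp hr).le]
  | a :: as, b :: bs =>
    rw [StartsGE] at h
    obtain ⟨hba, h⟩ := h
    by_cases hr : a ≤ r
    · simp [hr, hba.trans hr, StartsGE, hba, h]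
    · have ih := startsGE_orderedInsert r (b :: bs) as h
      have hra := (not_le.mp hr).le
      by_cases hrb : b ≤ r
      · simp only [List.orderedInsert_cons, ge_iff_le, hr, hrb, if_true, if_false] at ih ⊢
        rw [StartsGE]
        exact ⟨hra, ih⟩
      · simp only [List.orderedInsert_cons, ge_iff_le, hr, hrb, if_false] at ih ⊢
        rw [StartsGE]
        exact ⟨hba, ih⟩
termination_by l.length + m.length

theorem startsGE_of_separated (l m : List ℝ) (hl : l.Pairwise (· > ·)) (hm : m.Pairwise (· > ·))
    (hdisj : ∀ x ∈ l, x ∉ m) (htop : ∀ b ∈ m, ∃ a ∈ l, b < a)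
    (hlm : ∀ x ∈ l, ∀ y ∈ l, x < y → ∃ z ∈ m, x < z ∧ z < y)
    (hml : ∀ x ∈ m, ∀ y ∈ m, x < y → ∃ z ∈ l, x < z ∧ z < y) : StartsGE l m := by
  match l, m with
  | [], [] => simp [StartsGE]
  | [], b :: bs => simpa using htop b (by simp)
  | [a], [] => simp [StartsGE]
  | a :: a' :: as, [] =>
    have := hlm a' (by simp) a (by simp) (by simp at hl; exact hl.1.1)
    simp at this
  | a :: as, b :: bs =>
    rw [List.pairwise_cons] at hl
    have hma : ∀ x ∈ b :: bs, x < a := by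
      intro x hx
      obtain ⟨y, hy, hxy⟩ := htop x hx
      rcases List.mem_cons.mp hy with rfl | hy
      · exact hxy
      · exact hxy.trans (hl.1 y hy)
    rw [StartsGE]
    refine ⟨(hma b (by simp)).le, startsGE_of_separated (b :: bs) as hm hl.2 ?_ ?_ ?_ ?_⟩
    · intro x hx hx'
      exact hdisj x (by simp [hx']) hx
    · intro x hx
      obtain ⟨z, hz, hxz, -⟩ := hlm x (by simp [hx]) a (by simp) (hl.1 x hx)
      exact ⟨z, hz, hxz⟩
    · intro x hx y hy hxy
      obtain ⟨z, hz, hxz, hzy⟩ := hml x hx y hy hxy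
      rcases List.mem_cons.mp hz with rfl | hz
      · exact absurd (hma y hy) hzy.not_gt
      · exact ⟨z, hz, hxz, hzy⟩
    · intro x hx y hy hxy
      exact hlm x (by simp [hx]) y (by simp [hy]) hxy
termination_by l.length + m.length

theorem startsGE_or_of_separated (l m : List ℝ) (hl : l.Pairwise (· > ·))
    (hm : m.Pairwise (· > ·)) (hdisj : ∀ x ∈ l, x ∉ m)
    (hlm : ∀ x ∈ l, ∀ y ∈ l, x < y → ∃ z ∈ m, x < z ∧ z < y)
    (hml : ∀ x ∈ m, ∀ y ∈ m, x < y → ∃ z ∈ l, x < z ∧ z < y) :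
    StartsGE l m ∨ StartsGE m l := by
  by_cases htop : ∀ b ∈ m, ∃ a ∈ l, b < a
  · exact Or.inl (startsGE_of_separated l m hl hm hdisj htop hlm hml)
  · push Not at htop
    obtain ⟨b, hb, hab⟩ := htop
    refine Or.inr (startsGE_of_separated m l hm hl (fun x hx hx' => hdisj x hx' hx) ?_ hml hlm)
    intro a ha
    exact ⟨b, hb, lt_of_le_of_ne (hab a ha) fun h => hdisj a ha (h ▸ hb)⟩

theorem descRoots_pairwise (p : ℝ[X]) : (descRoots p).Pairwise (· ≥ ·) := by
  rw [descRoots, List.pairwise_reverse]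
  exact Multiset.pairwise_sort _ _

theorem coe_descRoots (p : ℝ[X]) : (descRoots p : Multiset ℝ) = p.roots := by
  rw [descRoots, Multiset.coe_reverse, Multiset.sort_eq]

theorem mem_descRoots {p : ℝ[X]} (hp : p ≠ 0) {x : ℝ} : x ∈ descRoots p ↔ p.eval x = 0 := by
  rw [← Multiset.mem_coe, coe_descRoots, mem_roots hp, IsRoot.def]

theorem descRoots_X_sub_C_mul {p : ℝ[X]} (hp : p ≠ 0) (r : ℝ) :
    descRoots ((Polynomial.X - Polynomial.C r) * p) =
      (descRoots p).orderedInsert (· ≥ ·) r := by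
  refine List.Perm.eq_of_pairwise' (r := (· ≥ ·)) (descRoots_pairwise _)
    ((descRoots_pairwise p).orderedInsert r _) ?_
  refine List.Perm.trans ?_ (List.perm_orderedInsert _ _ _).symm
  rw [← Multiset.coe_eq_coe, coe_descRoots, ← Multiset.cons_coe, coe_descRoots,
    roots_mul (mul_ne_zero (X_sub_C_ne_zero r) hp), roots_X_sub_C, Multiset.singleton_add]

theorem RootsInterlace.X_sub_C_mul {p q : ℝ[X]} (hp : p ≠ 0) (hq : q ≠ 0)
    (h : RootsInterlace p q) (r : ℝ) :
    RootsInterlace ((Polynomial.X - Polynomial.C r) * p)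
      ((Polynomial.X - Polynomial.C r) * q) := by
  rw [RootsInterlace, descRoots_X_sub_C_mul hp, descRoots_X_sub_C_mul hq]
  exact h.imp (startsGE_orderedInsert r _ _) (startsGE_orderedInsert r _ _)

theorem RootsInterlace.multiset_prod_mul {p q : ℝ[X]} (hp : p ≠ 0) (hq : q ≠ 0)
    (h : RootsInterlace p q) (s : Multiset ℝ) :
    RootsInterlace ((s.map fun r => Polynomial.X - Polynomial.C r).prod * p)
      ((s.map fun r => Polynomial.X - Polynomial.C r).prod * q) := by
  induction s using Multiset.induction_on with
  | empty => simpa using h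
  | cons r s ih =>
    have hs := (monic_multisetProd_X_sub_C s).ne_zero
    simp only [Multiset.map_cons, Multiset.prod_cons, mul_assoc]
    exact ih.X_sub_C_mul (mul_ne_zero hs hp) (mul_ne_zero hs hq) r

theorem RootsInterlace.mul_left {p q d : ℝ[X]} (hp : p ≠ 0) (hq : q ≠ 0) (hd : d ≠ 0)
    (h : RootsInterlace p q) : RootsInterlace (d * p) (d * q) := by
  have key : ∀ p : ℝ[X], p ≠ 0 → descRoots (d * p) =
      descRoots ((d.roots.map fun r => Polynomial.X - Polynomial.C r).prod * p) := by
    intro p hp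
    have hs := (monic_multisetProd_X_sub_C d.roots).ne_zero
    rw [descRoots, descRoots, roots_mul (mul_ne_zero hd hp), roots_mul (mul_ne_zero hs hp),
      roots_multiset_prod_X_sub_C]
  have h' := h.multiset_prod_mul hp hq d.roots
  rw [RootsInterlace] at h' ⊢
  rwa [key p hp, key q hq]

theorem wronskian_eval (p q : ℝ[X]) (x : ℝ) : (wronskian p q).eval x =
    p.eval x * q.derivative.eval x - p.derivative.eval x * q.eval x := by
  simp [wronskian]

theorem descRoots_pairwise_gt {p q : ℝ[X]} (h : ∀ x, (wronskian p q).eval x ≠ 0) :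
    (descRoots p).Pairwise (· > ·) := by
  have hp : p ≠ 0 := by
    rintro rfl
    simpa using h 0
  have hnd : (descRoots p).Nodup := by
    rw [← Multiset.coe_nodup, coe_descRoots, Multiset.nodup_iff_count_le_one]
    intro x
    rw [count_roots]
    by_contra! hx
    obtain ⟨h0, h1⟩ := (one_lt_rootMultiplicity_iff_isRoot hp).mp hx
    refine h x ?_
    rw [wronskian_eval, h0.eq_zero, h1.eq_zero]
    ring
  exact ((descRoots_pairwise p).and hnd).imp fun h => lt_of_le_of_ne h.1 h.2.symm

theorem exists_root_between {p q : ℝ[X]} (h : ∀ x, (wronskian p q).eval x ≠ 0) {x y : ℝ}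
    (hx : p.eval x = 0) (hy : p.eval y = 0) (hxy : x < y) :
    ∃ z, q.eval z = 0 ∧ x < z ∧ z < y := by
  by_contra! hq
  have hq0 : ∀ z ∈ Set.Icc x y, q.eval z ≠ 0 := by
    intro z hz hz0
    rcases hz.1.eq_or_lt with rfl | h1
    · refine h x ?_
      simp [wronskian_eval, hx, hz0]
    · rcases hz.2.eq_or_lt with rfl | h2
      · refine h z ?_
        simp [wronskian_eval, hy, hz0]
      · exact (hq z hz0 h1).not_gt h2
  obtain ⟨c, hc, hc0⟩ := exists_hasDerivAt_eq_zero
    (f := fun z => p.eval z / q.eval z) hxy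
    (p.continuous.continuousOn.div q.continuous.continuousOn hq0) (by simp [hx, hy])
    (fun z hz => (p.hasDerivAt z).div (q.hasDerivAt z) (hq0 z ⟨hz.1.le, hz.2.le⟩))
  have hqc := hq0 c ⟨hc.1.le, hc.2.le⟩
  refine h c ?_
  rw [div_eq_zero_iff] at hc0
  have := hc0.resolve_right (pow_ne_zero 2 hqc)
  rw [wronskian_eval]
  linarith

theorem rootsInterlace_of_wronskian_ne_zero {p q : ℝ[X]}
    (h : ∀ x, (wronskian p q).eval x ≠ 0) : RootsInterlace p q := by
  have hp : p ≠ 0 := by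
    rintro rfl
    simpa using h 0
  have hq : q ≠ 0 := by
    rintro rfl
    simpa using h 0
  have h' : ∀ x, (wronskian q p).eval x ≠ 0 := by
    intro x hx
    refine h x ?_
    rw [wronskian_eval] at hx ⊢
    linarith
  refine startsGE_or_of_separated _ _ (descRoots_pairwise_gt h) (descRoots_pairwise_gt h') ?_ ?_ ?_
  · intro x hx hx'
    rw [mem_descRoots hp] at hx
    rw [mem_descRoots hq] at hx'
    exact h x (by simp [wronskian_eval, hx, hx'])
  · intro x hx y hy hxy
    simp only [mem_descRoots hp, mem_descRoots hq] at hx hy ⊢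
    exact exists_root_between h hx hy hxy
  · intro x hx y hy hxy
    simp only [mem_descRoots hp, mem_descRoots hq] at hx hy ⊢
    exact exists_root_between h' hx hy hxy

theorem properPosition_mul_left {d p q : ℝ[X]} (hd : d ≠ 0)
    (h : ∀ x, (wronskian p q).eval x < 0) : ProperPosition (d * q) (d * p) := by
  have hp : p ≠ 0 := by
    rintro rfl
    simpa using h 0
  have hq : q ≠ 0 := by
    rintro rfl
    simpa using h 0
  refine ⟨(rootsInterlace_of_wronskian_ne_zero fun x => (h x).ne).mul_left hp hq hd, fun x => ?_⟩
  have hx := h x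
  rw [wronskian_eval] at hx
  simp only [derivative_mul, Polynomial.eval_add, Polynomial.eval_mul]
  nlinarith [mul_nonneg (sq_nonneg (d.eval x)) (neg_nonneg.mpr hx.le)]

theorem C_eval_mul_lagrange_basis {s : Finset ℝ} (b : ℝ) :
    Polynomial.C ((Lagrange.nodal (s.erase b) id).eval b) * Lagrange.basis s id b =
      Lagrange.nodal (s.erase b) id := by
  rw [Lagrange.eval_nodal, Lagrange.nodal_eq, Lagrange.basis, map_prod, ← Finset.prod_mul_distrib]
  refine Finset.prod_congr rfl fun i hi => ?_
  have : b - i ≠ 0 := sub_ne_zero.mpr (Finset.ne_of_mem_erase hi).symm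
  rw [Lagrange.basisDivisor, ← mul_assoc, ← Polynomial.C_mul, id, id, mul_inv_cancel₀ this,
    Polynomial.C_1, one_mul]

theorem exists_eq_linear_mul_add {p q : ℝ[X]} (hdeg : p.natDegree = q.natDegree + 1)
    (hlc : 0 < p.leadingCoeff * q.leadingCoeff) :
    ∃ a c : ℝ, ∃ r : ℝ[X], 0 < a ∧ r.degree < q.degree ∧
      p = q * (Polynomial.C a * Polynomial.X + Polynomial.C c) + r := by
  have hq : q ≠ 0 := by
    rintro rfl
    simp at hlc
  have hp : p ≠ 0 := by
    rintro rfl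
    simp at hlc
  have hle : q.degree ≤ p.degree := by
    rw [degree_eq_natDegree hq, degree_eq_natDegree hp, hdeg]
    exact_mod_cast Nat.le_succ _
  have hdiv := degree_add_div hq hle
  have hne : p / q ≠ 0 := by
    intro h
    have := leadingCoeff_div hle
    rw [h, leadingCoeff_zero, eq_comm, div_eq_zero_iff] at this
    simp_all
  have hnd : (p / q).natDegree = 1 := by
    rw [degree_eq_natDegree hq, degree_eq_natDegree hp, degree_eq_natDegree hne, hdeg] at hdiv
    have : q.natDegree + (p / q).natDegree = q.natDegree + 1 := by exact_mod_cast hdiv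
    omega
  refine ⟨(p / q).coeff 1, (p / q).coeff 0, p % q, ?_, EuclideanDomain.mod_lt p hq, ?_⟩
  · rw [← hnd, coeff_natDegree, leadingCoeff_div hle]
    rcases mul_pos_iff.mp hlc with h | h
    · exact div_pos h.1 h.2
    · exact div_pos_of_neg_of_neg h.1 h.2
  · rw [← eq_X_add_C_of_natDegree_le_one hnd.le, EuclideanDomain.div_add_mod]

theorem wronskian_neg_of_residues {p q : ℝ[X]} (hq : q.Splits)
    (hdeg : p.natDegree = q.natDegree + 1) (hlc : 0 < p.leadingCoeff * q.leadingCoeff)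
    (hroot : ∀ b, q.eval b = 0 → p.eval b * q.derivative.eval b < 0) (x : ℝ) :
    (wronskian p q).eval x < 0 := by
  have hq0 : q ≠ 0 := by
    rintro rfl
    simp at hlc
  obtain ⟨a, c, r, ha, hr, hp⟩ := exists_eq_linear_mul_add hdeg hlc
  have hnd : q.roots.Nodup := by
    rw [Multiset.nodup_iff_count_le_one]
    intro b
    rw [count_roots]
    by_contra! hb
    obtain ⟨h0, h1⟩ := (one_lt_rootMultiplicity_iff_isRoot hq0).mp hb
    have := hroot b h0.eq_zero
    rw [h1.eq_zero] at this
    simp at this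
  set s : Finset ℝ := q.roots.toFinset with hs
  have hmem : ∀ b, b ∈ s ↔ q.eval b = 0 := by
    intro b
    rw [hs, Multiset.mem_toFinset, mem_roots hq0, IsRoot.def]
  have hnodal : q = Polynomial.C q.leadingCoeff * Lagrange.nodal s id := by
    conv_lhs => rw [hq.eq_prod_roots]
    congr 1
    rw [Lagrange.nodal_eq, Finset.prod, hs, Multiset.toFinset_val, hnd.dedup]
    rfl
  have hinj : Set.InjOn (id : ℝ → ℝ) s := Set.injOn_id _
  have hcard : q.degree = s.card := by
    conv_lhs => rw [hnodal]
    rw [degree_C_mul (leadingCoeff_ne_zero.mpr hq0), Lagrange.degree_nodal]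
  have hfac : ∀ b ∈ s, q = Polynomial.C (q.derivative.eval b) *
      ((Polynomial.X - Polynomial.C b) * Lagrange.basis s id b) := by
    intro b hb
    have hd : q.derivative.eval b =
        q.leadingCoeff * (Lagrange.nodal (s.erase b) id).eval b := by
      conv_lhs => rw [hnodal]
      rw [derivative_C_mul, Polynomial.eval_mul, Polynomial.eval_C]
      congr 1
      exact Lagrange.eval_nodal_derivative_eval_node_eq (v := id) hb
    rw [hd, Polynomial.C_mul, mul_assoc, mul_left_comm (Polynomial.C (Polynomial.eval _ _)),
      C_eval_mul_lagrange_basis]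
    conv_lhs => rw [hnodal, Lagrange.nodal_eq_mul_nodal_erase hb]
    rfl
  have hr' : r = ∑ b ∈ s, Polynomial.C (r.eval b) * Lagrange.basis s id b := by
    have hi := Lagrange.eq_interpolate (f := r) (v := id) hinj (by rwa [← hcard])
    rwa [Lagrange.interpolate_apply] at hi
  have hrp : ∀ b ∈ s, r.eval b = p.eval b := by
    intro b hb
    rw [hp]
    simp [(hmem b).mp hb]
  have hW : (wronskian p q).eval x = -a * (q.eval x) ^ 2 +
      ∑ b ∈ s, p.eval b * q.derivative.eval b * ((Lagrange.basis s id b).eval x) ^ 2 := by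
    have hsum : (wronskian r q).eval x =
        ∑ b ∈ s, p.eval b * q.derivative.eval b * ((Lagrange.basis s id b).eval x) ^ 2 := by
      have hlin : wronskian r q =
          ∑ b ∈ s, wronskian (Polynomial.C (r.eval b) * Lagrange.basis s id b) q := by
        conv_lhs => rw [hr']
        simp only [wronskian, derivative_sum, Finset.sum_mul, ← Finset.sum_sub_distrib]
      rw [hlin, eval_finsetSum]
      refine Finset.sum_congr rfl fun b hb => ?_
      rw [← hrp b hb]
      have hf := hfac b hb
      generalize q.derivative.eval b = t at hf ⊢
      rw [hf]
      simp [wronskian]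
      ring
    conv_lhs => rw [hp]
    rw [wronskian_add_left, Polynomial.eval_add, hsum]
    congr 1
    simp [wronskian]
    ring
  have hterm : ∀ b ∈ s, p.eval b * q.derivative.eval b *
      ((Lagrange.basis s id b).eval x) ^ 2 ≤ 0 := fun b hb =>
    mul_nonpos_of_nonpos_of_nonneg (hroot b ((hmem b).mp hb)).le (sq_nonneg _)
  rw [hW]
  by_cases hx : q.eval x = 0
  · have hxs := (hmem x).mpr hx
    have h1 : ∑ b ∈ s, p.eval b * q.derivative.eval b *
        ((Lagrange.basis s id b).eval x) ^ 2 < 0 := by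
      refine Finset.sum_neg' hterm ⟨x, hxs, ?_⟩
      have := Lagrange.eval_basis_self hinj hxs
      rw [id] at this
      rw [this]
      simpa using hroot x hx
    simpa [hx] using h1
  · have h1 := Finset.sum_nonpos hterm
    have h2 := mul_pos ha (pow_pos (abs_pos.mpr hx) 2)
    rw [sq_abs] at h2
    linarith

open Filter Topology ComplexConjugate

theorem im_leading_term_nonneg {A B : ℂ[X]} {z w : ℂ} {k : ℕ}
    (h : ∀ᶠ t : ℝ in 𝓝[>] 0, 0 ≤ (A.eval (z + t * w) *
      conj ((t * w) ^ k * B.eval (z + t * w))).im) :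
    0 ≤ (A.eval z * conj (w ^ k * B.eval z)).im := by
  have hcont : Continuous fun t : ℝ => (A.eval (z + t * w) *
      conj (w ^ k * B.eval (z + t * w))).im := by
    have h1 : Continuous fun t : ℝ => z + t * w := by fun_prop
    exact Complex.continuous_im.comp ((A.continuous.comp h1).mul
      (Complex.continuous_conj.comp (continuous_const.mul (B.continuous.comp h1))))
  have hlim := (hcont.tendsto 0).mono_left (nhdsWithin_le_nhds (s := Set.Ioi (0 : ℝ)))
  simp only [Complex.ofReal_zero, zero_mul, add_zero] at hlim
  refine ge_of_tendsto hlim ?_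
  filter_upwards [h, self_mem_nhdsWithin] with t ht ht0
  have ht0 : 0 < t ^ k := pow_pos ht0 k
  have he : A.eval (z + t * w) * conj ((t * w) ^ k * B.eval (z + t * w)) =
      ((t ^ k : ℝ) : ℂ) * (A.eval (z + t * w) * conj (w ^ k * B.eval (z + t * w))) := by
    simp only [mul_pow, map_mul, map_pow, Complex.conj_ofReal, Complex.ofReal_pow]
    ring
  rw [he, Complex.im_ofReal_mul] at ht
  exact nonneg_of_mul_nonneg_right ht ht0

theorem eval_ne_zero_of_im_nonneg {A B : ℂ[X]} (hB : B ≠ 0)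
    (h : ∀ z : ℂ, 0 < z.im → 0 ≤ (A.eval z * conj (B.eval z)).im)
    (hAB : ∀ z : ℂ, 0 < z.im → A.eval z = 0 → B.eval z ≠ 0) {z : ℂ} (hz : 0 < z.im) :
    B.eval z ≠ 0 := by
  intro hBz
  have hAz : A.eval z ≠ 0 := fun h0 => hAB z hz h0 hBz
  obtain ⟨B', hB', hnd⟩ := exists_eq_pow_rootMultiplicity_mul_and_not_dvd B hB z
  have hk : B.rootMultiplicity z ≠ 0 := ((rootMultiplicity_pos hB).mpr hBz).ne'
  set k := B.rootMultiplicity z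
  have hB'z : B'.eval z ≠ 0 := fun h0 => hnd (dvd_iff_isRoot.mpr h0)
  set c := A.eval z * conj (B'.eval z) with hc
  have hc0 : c ≠ 0 := mul_ne_zero hAz (by simpa using hB'z)
  obtain ⟨w, hw⟩ := IsAlgClosed.exists_pow_nat_eq (conj (-Complex.I / c)) (Nat.pos_of_ne_zero hk)
  have key : 0 ≤ (A.eval z * conj (w ^ k * B'.eval z)).im := by
    refine im_leading_term_nonneg ?_
    have h1 : Tendsto (fun t : ℝ => (z + t * w).im) (𝓝[>] 0) (𝓝 z.im) := by
      have hcont : Continuous fun t : ℝ => (z + t * w).im := by fun_prop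
      simpa using (hcont.tendsto 0).mono_left (nhdsWithin_le_nhds (s := Set.Ioi (0 : ℝ)))
    filter_upwards [h1.eventually (lt_mem_nhds hz)] with t ht
    have := h _ ht
    rw [hB'] at this
    simpa using this
  rw [hw, map_mul, Complex.conj_conj] at key
  have : A.eval z * (-Complex.I / c * conj (B'.eval z)) = -Complex.I := by
    rw [mul_left_comm, ← hc, div_mul_cancel₀ _ hc0]
  rw [this] at key
  norm_num at key

theorem splits_of_eval_ne_zero {p : ℝ[X]}
    (h : ∀ z : ℂ, 0 < z.im → (p.map (algebraMap ℝ ℂ)).eval z ≠ 0) : p.Splits := by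
  refine Splits.of_splits_map (algebraMap ℝ ℂ) (IsAlgClosed.splits _) fun z hz => ?_
  have hz0 := (mem_roots'.mp hz).2.eq_zero
  have hconj : (p.map (algebraMap ℝ ℂ)).eval (conj z) = 0 := by
    have := congrArg conj hz0
    rw [eval_map_algebraMap] at this ⊢
    rw [aeval_conj, this, map_zero]
  rcases lt_trichotomy z.im 0 with hneg | h0 | hpos
  · exact absurd hconj (h _ (by simpa using hneg))
  · exact ⟨z.re, Complex.ext (by simp) (by simp [h0])⟩
  · exact absurd hz0 (h z hpos)

theorem eval_map_ofReal (p : ℝ[X]) (x : ℝ) :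
    (p.map (algebraMap ℝ ℂ)).eval (x : ℂ) = (p.eval x : ℝ) := by
  rw [eval_map_algebraMap]
  exact aeval_algebraMap_apply_eq_algebraMap_eval x p

theorem exists_im_pos_pow {k : ℕ} (hk : 2 ≤ k) :
    (∃ w : ℂ, 0 < w.im ∧ 0 < (w ^ k).im) ∧ ∃ w : ℂ, 0 < w.im ∧ (w ^ k).im < 0 := by
  have hk' : (2 : ℝ) ≤ k := by exact_mod_cast hk
  have hk0 : (k : ℝ) ≠ 0 := by positivity
  have him : ∀ θ : ℝ, (Complex.exp (θ * Complex.I)).im = Real.sin θ := fun θ =>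
    Complex.exp_ofReal_mul_I_im θ
  have hpow : ∀ θ : ℝ, Complex.exp ((θ / k : ℝ) * Complex.I) ^ k =
      Complex.exp (θ * Complex.I) := by
    intro θ
    rw [← Complex.exp_nat_mul]
    congr 1
    push_cast
    have : (k : ℂ) ≠ 0 := by exact_mod_cast hk0
    field_simp
  have hpi := Real.pi_pos
  refine ⟨⟨Complex.exp ((Real.pi / 2 / k : ℝ) * Complex.I), ?_, ?_⟩,
    ⟨Complex.exp ((3 * Real.pi / 2 / k : ℝ) * Complex.I), ?_, ?_⟩⟩
  · rw [him]
    refine Real.sin_pos_of_pos_of_lt_pi (by positivity) ?_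
    rw [div_lt_iff₀ (by positivity)]
    nlinarith
  · rw [hpow, him, Real.sin_pi_div_two]
    exact one_pos
  · rw [him]
    refine Real.sin_pos_of_pos_of_lt_pi (by positivity) ?_
    rw [div_lt_iff₀ (by positivity)]
    nlinarith
  · rw [hpow, him, show 3 * Real.pi / 2 = Real.pi / 2 + Real.pi by ring, Real.sin_add_pi,
      Real.sin_pi_div_two]
    norm_num

theorem eval_mul_derivative_neg {a b : ℝ[X]} (hb : b ≠ 0) (hab : IsCoprime a b)
    (h : ∀ z : ℂ, 0 < z.im → 0 ≤ ((a.map (algebraMap ℝ ℂ)).eval z *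
      conj ((b.map (algebraMap ℝ ℂ)).eval z)).im) {x : ℝ} (hx : b.eval x = 0) :
    a.eval x * b.derivative.eval x < 0 := by
  have hax : a.eval x ≠ 0 := by
    intro hax
    obtain ⟨u, v, huv⟩ := hab
    have := congrArg (Polynomial.eval x) huv
    simp [hax, hx] at this
  obtain ⟨b', hb', hnd⟩ := exists_eq_pow_rootMultiplicity_mul_and_not_dvd b hb x
  have hk : b.rootMultiplicity x ≠ 0 := ((rootMultiplicity_pos hb).mpr hx).ne'
  set k := b.rootMultiplicity x
  have hbx : b'.eval x ≠ 0 := fun h0 => hnd (dvd_iff_isRoot.mpr h0)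
  have key : ∀ w : ℂ, 0 < w.im → a.eval x * b'.eval x * (w ^ k).im ≤ 0 := by
    intro w hw
    have := im_leading_term_nonneg (A := a.map (algebraMap ℝ ℂ))
      (B := b'.map (algebraMap ℝ ℂ)) (z := x) (w := w) (k := k) ?_
    · rw [eval_map_ofReal, eval_map_ofReal, Complex.im_ofReal_mul, map_mul, Complex.conj_ofReal,
        Complex.im_mul_ofReal, Complex.conj_im] at this
      linarith
    · filter_upwards [self_mem_nhdsWithin] with t ht
      have := h (x + t * w) (by simpa using mul_pos ht hw)
      rw [hb'] at this
      simpa using this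
  have hc := mul_ne_zero hax hbx
  have hk1 : k = 1 := by
    by_contra hk1
    obtain ⟨⟨w, hw, hwk⟩, ⟨w', hw', hwk'⟩⟩ := exists_im_pos_pow (k := k) (by omega)
    have h1 := key w hw
    have h2 := key w' hw'
    rcases lt_or_gt_of_ne hc with hc | hc
    · linarith [mul_pos_of_neg_of_neg hc hwk']
    · linarith [mul_pos hc hwk]
  have hd : b.derivative.eval x = b'.eval x := by
    rw [hb', hk1]
    simp
  rw [hd]
  refine lt_of_le_of_ne ?_ hc
  simpa [hk1] using key Complex.I (by simp)

theorem exists_isCoprime_factorization (a : ℝ[X]) {b : ℝ[X]} (hb : b ≠ 0) :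
    ∃ d a' b' : ℝ[X], IsCoprime a' b' ∧ a = d * a' ∧ b = d * b' := by
  obtain ⟨a', ha'⟩ := EuclideanDomain.gcd_dvd_left a b
  obtain ⟨b', hb'⟩ := EuclideanDomain.gcd_dvd_right a b
  have hd : EuclideanDomain.gcd a b ≠ 0 := fun h => hb (EuclideanDomain.gcd_eq_zero_iff.mp h).2
  refine ⟨EuclideanDomain.gcd a b, a', b', ?_, ha', hb'⟩
  have h := EuclideanDomain.gcd_eq_gcd_ab a b
  generalize EuclideanDomain.gcd a b = d at *
  refine ⟨EuclideanDomain.gcdA a b, EuclideanDomain.gcdB a b, mul_left_cancel₀ hd ?_⟩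
  linear_combination -h - EuclideanDomain.gcdA a b * ha' - EuclideanDomain.gcdB a b * hb'

theorem properPosition_of_im_nonneg {a b : ℝ[X]} {e s : ℝ} (g : ℝ)
    (hdeg : a.natDegree = b.natDegree) (hlc : 0 < a.leadingCoeff * b.leadingCoeff)
    (hb : ∀ z : ℂ, 0 < z.im → (b.map (algebraMap ℝ ℂ)).eval z ≠ 0)
    (h : ∀ z : ℂ, 0 < z.im → 0 ≤ s * ((a.map (algebraMap ℝ ℂ)).eval z *
      conj ((b.map (algebraMap ℝ ℂ)).eval z)).im)
    (hs : s ≠ 0) (hroot : ∀ x, b.eval x = 0 → 0 ≤ s * (x - e)) :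
    ProperPosition b ((Polynomial.X - Polynomial.C e) * a - Polynomial.C g * b) := by
  have hb0 : b ≠ 0 := by
    rintro rfl
    simp at hlc
  have hsplit := splits_of_eval_ne_zero hb
  obtain ⟨d, a', b', hcop, rfl, rfl⟩ := exists_isCoprime_factorization a hb0
  have hd0 := left_ne_zero_of_mul hb0
  have hb'0 := right_ne_zero_of_mul hb0
  have ha'0 : a' ≠ 0 := by
    rintro rfl
    simp at hlc
  rw [natDegree_mul hd0 ha'0, natDegree_mul hd0 hb'0, Nat.add_left_cancel_iff] at hdeg
  have hlc' : 0 < a'.leadingCoeff * b'.leadingCoeff := by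
    rw [leadingCoeff_mul, leadingCoeff_mul, mul_mul_mul_comm] at hlc
    exact (mul_pos_iff_of_pos_left (mul_self_pos.mpr (leadingCoeff_ne_zero.mpr hd0))).mp hlc
  have hsplit' : b'.Splits := hsplit.of_dvd hb0 (dvd_mul_left _ _)
  have hres : ∀ x, b'.eval x = 0 → s * (a'.eval x * b'.derivative.eval x) < 0 := by
    intro x hx
    have hunit : IsUnit (Polynomial.C s) := isUnit_C.mpr hs.isUnit
    have := eval_mul_derivative_neg (a := Polynomial.C s * a') hb'0
      ((isCoprime_mul_unit_left_left hunit _ _).mpr hcop) ?_ hx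
    · simpa [mul_assoc] using this
    · intro z hz
      have h1 := h z hz
      have h2 := hb z hz
      rw [Polynomial.map_mul, Polynomial.eval_mul] at h1 h2
      rw [Polynomial.map_mul, Polynomial.eval_mul] at h1
      have h3 := Complex.normSq_pos.mpr (left_ne_zero_of_mul h2)
      refine nonneg_of_mul_nonneg_right (a := Complex.normSq ((d.map (algebraMap ℝ ℂ)).eval z))
        (h1.trans_eq ?_) h3
      rw [← Complex.im_ofReal_mul, ← Complex.im_ofReal_mul, ← Complex.mul_conj]
      congr 1
      simp
      ring
  have hshift : ∀ p q : ℝ[X], ∀ x, (wronskian (p - Polynomial.C g * q) q).eval x =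
      (wronskian p q).eval x := by
    intro p q x
    simp [wronskian]
    ring
  by_cases he : b'.eval e = 0
  · obtain ⟨q, rfl⟩ := dvd_iff_isRoot.mpr he
    have hq0 := right_ne_zero_of_mul hb'0
    have hX := Polynomial.X_sub_C_ne_zero e
    have := properPosition_mul_left (p := a' - Polynomial.C g * q) (q := q)
      (mul_ne_zero hd0 hX) fun x => ?_
    · convert this using 1 <;> ring
    · rw [hshift]
      refine wronskian_neg_of_residues (hsplit'.of_dvd hb'0 (dvd_mul_left _ _)) ?_ ?_ ?_ x
      · rw [hdeg, natDegree_mul hX hq0, natDegree_X_sub_C, add_comm]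
      · simpa using hlc'
      · intro y hy
        have h1 := hres y (by simp [hy])
        have h2 := hroot y (by simp [hy])
        simp only [derivative_mul, Polynomial.eval_add, Polynomial.eval_mul, hy] at h1
        simp at h1
        by_contra! h3
        nlinarith [mul_nonneg h2 h3]
  · have := properPosition_mul_left
      (p := (Polynomial.X - Polynomial.C e) * a' - Polynomial.C g * b') (q := b') hd0 fun x => ?_
    · convert this using 1
      ring
    · have hX := Polynomial.X_sub_C_ne_zero e
      rw [hshift]
      refine wronskian_neg_of_residues hsplit' ?_ ?_ ?_ x
      · rw [natDegree_mul hX ha'0, natDegree_X_sub_C, hdeg, add_comm]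
      · simpa using hlc'
      · intro y hy
        have h1 := hres y hy
        have h2 := (hroot y (by simp [hy])).lt_of_ne' (mul_ne_zero hs (sub_ne_zero.mpr ?_))
        · have := mul_neg_of_pos_of_neg h2 h1
          have h3 : 0 < s ^ 2 := by positivity
          simp
          by_contra! h4
          nlinarith [mul_nonneg h3.le h4]
        · rintro rfl
          exact he hy

theorem expOf_prod {n : ℕ} {R : Type*} [CommSemiring R] (A : Finset (Fin n)) (z : Fin n → R) :
    ((expOf A).prod fun i k => z i ^ k) = ∏ i ∈ A, z i := by
  rw [expOf, ← Finsupp.prod_finsetSum_index (by simp) (by simp [pow_add])]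
  simp

theorem diagPoly_monomial_expOf {n : ℕ} (A : Finset (Fin n)) (c : ℝ) :
    diagPoly (MvPolynomial.monomial (expOf A) c) = Polynomial.C c * Polynomial.X ^ A.card := by
  rw [diagPoly, MvPolynomial.aeval_monomial, expOf_prod]
  simp

theorem diagPoly_kernelPoly {n : ℕ} (ν : Finset (Fin n) → ℝ) :
    diagPoly (kernelPoly ν) = ∑ B : Finset (Fin n), Polynomial.C (ν B) *
      ((Polynomial.X - 1) ^ B.card * Polynomial.X ^ (n - B.card)) := by
  have hsum : diagPoly (kernelPoly ν) = ∑ A : Finset (Fin n),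
      diagPoly (MvPolynomial.monomial (expOf Aᶜ) ((-1 : ℝ) ^ A.card * probSupset ν A)) := by
    rw [kernelPoly, diagPoly, map_sum]
    rfl
  have hterm : ∀ B : Finset (Fin n),
      ((Polynomial.X - 1) ^ B.card * Polynomial.X ^ (n - B.card) : ℝ[X]) =
        ∑ A ∈ B.powerset, (-1) ^ A.card * Polynomial.X ^ (n - A.card) := by
    intro B
    rw [sub_eq_neg_add, ← Finset.sum_pow_mul_eq_add_pow, Finset.sum_mul]
    refine Finset.sum_congr rfl fun A hA => ?_
    have h1 := Finset.card_le_card (Finset.mem_powerset.mp hA)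
    have h2 := B.card_le_univ
    rw [Fintype.card_fin] at h2
    rw [mul_assoc, ← pow_add]
    congr 2
    omega
  rw [hsum]
  simp_rw [diagPoly_monomial_expOf, probSupset, hterm, Finset.mul_sum, map_sum, Finset.sum_mul]
  have hmem : ∀ A B : Finset (Fin n), (A ∈ Finset.univ ∧
      B ∈ Finset.univ.filter fun B : Finset (Fin n) => A ⊆ B) ↔
      (A ∈ B.powerset ∧ B ∈ Finset.univ) := by simp
  rw [Finset.sum_comm' hmem]
  refine Finset.sum_congr rfl fun B _ => Finset.sum_congr rfl fun A _ => ?_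
  rw [Finset.card_compl, Fintype.card_fin]
  simp
  ring

theorem eval_genPoly {n : ℕ} (μ : Finset (Fin n) → ℝ) (z : Fin n → ℂ) :
    MvPolynomial.eval z (MvPolynomial.map (algebraMap ℝ ℂ) (genPoly μ)) =
      ∑ A : Finset (Fin n), (μ A : ℂ) * ∏ i ∈ A, z i := by
  simp only [genPoly, map_sum, MvPolynomial.map_monomial, MvPolynomial.eval_monomial, expOf_prod]
  rfl

theorem sum_finset_fin_succ {n : ℕ} {M : Type*} [AddCommMonoid M]
    (F : Finset (Fin (n + 1)) → M) :
    ∑ A, F A = ∑ B : Finset (Fin n), F (insert (Fin.last n) (B.map Fin.castSuccEmb)) +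
      ∑ B : Finset (Fin n), F (B.map Fin.castSuccEmb) := by
  have hlast : Fin.last n ∉ Finset.univ.map (Fin.castSuccEmb (n := n)) := by simp
  rw [← Finset.powerset_univ, Fin.univ_castSuccEmb, Finset.cons_eq_insert,
    Finset.sum_powerset_insert hlast, add_comm]
  have hmap : ∀ G : Finset (Fin (n + 1)) → M,
      ∑ A ∈ (Finset.univ.map Fin.castSuccEmb).powerset, G A =
        ∑ B : Finset (Fin n), G (B.map Fin.castSuccEmb) := by
    intro G
    refine (Finset.sum_nbij (fun B : Finset (Fin n) => B.map Fin.castSuccEmb) (fun B _ => ?_)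
      (Finset.map_injective _).injOn (fun A hA => ?_) fun _ _ => rfl).symm
    · exact Finset.mem_powerset.mpr (Finset.map_subset_map.mpr (Finset.subset_univ B))
    · obtain ⟨B, -, rfl⟩ := Finset.subset_map_iff.mp (Finset.mem_powerset.mp hA)
      exact ⟨B, by simp, rfl⟩
  rw [hmap, hmap]

theorem last_notMem_map {n : ℕ} (B : Finset (Fin n)) : Fin.last n ∉ B.map Fin.castSuccEmb := by
  simp

theorem probMem_last {n : ℕ} (μ : Finset (Fin (n + 1)) → ℝ) : probMem μ (Fin.last n) =
    ∑ B : Finset (Fin n), μ (insert (Fin.last n) (B.map Fin.castSuccEmb)) := by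
  rw [probMem, Finset.sum_filter, sum_finset_fin_succ]
  simp

theorem one_sub_probMem_last {n : ℕ} {μ : Finset (Fin (n + 1)) → ℝ} (hμ : IsPointProcess μ) :
    1 - probMem μ (Fin.last n) = ∑ B : Finset (Fin n), μ (B.map Fin.castSuccEmb) := by
  rw [← hμ.2, sum_finset_fin_succ, probMem_last, add_sub_cancel_left]

theorem isPointProcess_condIn {n : ℕ} {μ : Finset (Fin (n + 1)) → ℝ} (hμ : IsPointProcess μ)
    (hp : 0 < probMem μ (Fin.last n)) : IsPointProcess (condIn μ) := by
  refine ⟨fun B => div_nonneg (hμ.1 _) hp.le, ?_⟩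
  simp only [condIn]
  rw [← Finset.sum_div, ← probMem_last, div_self hp.ne']

theorem isPointProcess_condOut {n : ℕ} {μ : Finset (Fin (n + 1)) → ℝ} (hμ : IsPointProcess μ)
    (hp : probMem μ (Fin.last n) < 1) : IsPointProcess (condOut μ) := by
  have hp' := sub_pos.mpr hp
  refine ⟨fun B => div_nonneg (hμ.1 _) hp'.le, ?_⟩
  simp only [condOut]
  rw [← Finset.sum_div, ← one_sub_probMem_last hμ, div_self hp'.ne']

theorem diagPoly_kernelPoly_eq_condIn_add_condOut {n : ℕ} {μ : Finset (Fin (n + 1)) → ℝ}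
    (hp0 : probMem μ (Fin.last n) ≠ 0) (hp1 : 1 - probMem μ (Fin.last n) ≠ 0) :
    diagPoly (kernelPoly μ) =
      (Polynomial.X - 1) *
        (Polynomial.C (probMem μ (Fin.last n)) * diagPoly (kernelPoly (condIn μ))) +
      Polynomial.X *
        (Polynomial.C (1 - probMem μ (Fin.last n)) * diagPoly (kernelPoly (condOut μ))) := by
  simp_rw [diagPoly_kernelPoly]
  rw [sum_finset_fin_succ]
  simp_rw [Finset.mul_sum]
  refine congrArg₂ (· + ·) ?_ ?_
  · refine Finset.sum_congr rfl fun B _ => ?_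
    rw [Finset.card_insert_of_notMem (last_notMem_map B), Finset.card_map,
      Nat.add_sub_add_right, condIn, ← mul_assoc (Polynomial.C _) (Polynomial.C _),
      ← Polynomial.C_mul, mul_div_cancel₀ _ hp0]
    ring
  · refine Finset.sum_congr rfl fun B _ => ?_
    have h := B.card_le_univ
    rw [Fintype.card_fin] at h
    rw [Finset.card_map, Nat.sub_add_comm h, condOut,
      ← mul_assoc (Polynomial.C _) (Polynomial.C _), ← Polynomial.C_mul, mul_div_cancel₀ _ hp1]
    ring

theorem diagPoly_kernelPoly_natDegree_le {n : ℕ} (ν : Finset (Fin n) → ℝ) :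
    (diagPoly (kernelPoly ν)).natDegree ≤ n := by
  rw [diagPoly_kernelPoly]
  refine natDegree_sum_le_of_forall_le _ _ fun B _ => ?_
  refine (natDegree_C_mul_le _ _).trans (natDegree_mul_le.trans ?_)
  have h := B.card_le_univ
  rw [Fintype.card_fin] at h
  rw [natDegree_X_pow, ← Polynomial.C_1, natDegree_pow, natDegree_X_sub_C]
  omega

theorem diagPoly_kernelPoly_coeff {n : ℕ} {ν : Finset (Fin n) → ℝ} (hν : IsPointProcess ν) :
    (diagPoly (kernelPoly ν)).coeff n = 1 := by
  rw [diagPoly_kernelPoly, finsetSum_coeff, ← hν.2]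
  refine Finset.sum_congr rfl fun B _ => ?_
  have h := B.card_le_univ
  rw [Fintype.card_fin] at h
  have hm : ((Polynomial.X - 1) ^ B.card * Polynomial.X ^ (n - B.card) : ℝ[X]).Monic := by
    rw [← Polynomial.C_1]
    exact ((monic_X_sub_C 1).pow _).mul (monic_X_pow _)
  have hd : ((Polynomial.X - 1) ^ B.card * Polynomial.X ^ (n - B.card) : ℝ[X]).natDegree = n := by
    rw [← Polynomial.C_1, ((monic_X_sub_C (1 : ℝ)).pow _).natDegree_mul (monic_X_pow _),
      natDegree_X_pow, natDegree_pow, natDegree_X_sub_C]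
    omega
  have hc := hm.coeff_natDegree
  rw [hd] at hc
  rw [Polynomial.coeff_C_mul, hc, mul_one]

theorem natDegree_leadingCoeff_of_coeff_eq_one {p : ℝ[X]} {n : ℕ} (hd : p.natDegree ≤ n)
    (hc : p.coeff n = 1) : p.natDegree = n ∧ p.leadingCoeff = 1 := by
  have : p.natDegree = n := natDegree_eq_of_le_of_coeff_ne_zero hd (by simp [hc])
  exact ⟨this, by rw [leadingCoeff, this, hc]⟩

theorem IsPointProcess.sum_mul_pos {n : ℕ} {ν : Finset (Fin n) → ℝ} (hν : IsPointProcess ν)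
    {F : Finset (Fin n) → ℝ} (hF : ∀ B, 0 < F B) : 0 < ∑ B, ν B * F B := by
  obtain ⟨B, -, hB⟩ : ∃ B ∈ Finset.univ, 0 < ν B := by
    refine Finset.exists_lt_of_sum_lt ?_
    rw [hν.2]
    simp
  exact Finset.sum_pos' (fun A _ => mul_nonneg (hν.1 A) (hF A).le)
    ⟨B, Finset.mem_univ B, mul_pos hB (hF B)⟩

theorem diagPoly_kernelPoly_eval_root {n : ℕ} {ν : Finset (Fin n) → ℝ} (hν : IsPointProcess ν)
    {x : ℝ} (hx : (diagPoly (kernelPoly ν)).eval x = 0) : 0 ≤ x ∧ x ≤ 1 := by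
  have heval : ∑ B, ν B * ((x - 1) ^ B.card * x ^ (n - B.card)) = 0 := by
    rw [← hx, diagPoly_kernelPoly, eval_finsetSum]
    simp
  constructor
  · by_contra! h
    have := hν.sum_mul_pos (F := fun B => (1 - x) ^ B.card * (-x) ^ (n - B.card)) fun B =>
      mul_pos (pow_pos (by linarith) _) (pow_pos (by linarith) _)
    refine this.ne' ?_
    rw [← mul_zero ((-1) ^ n), ← heval, Finset.mul_sum]
    refine Finset.sum_congr rfl fun B _ => ?_
    have h := B.card_le_univ
    rw [Fintype.card_fin] at h
    have hpow : (-1 : ℝ) ^ n = (-1) ^ B.card * (-1) ^ (n - B.card) := by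
      rw [← pow_add, Nat.add_sub_cancel' h]
    rw [← neg_sub x 1, neg_pow (x - 1), neg_pow x, hpow]
    ring
  · by_contra! h
    exact (hν.sum_mul_pos (F := fun B => (x - 1) ^ B.card * x ^ (n - B.card)) fun B =>
      mul_pos (pow_pos (by linarith) _) (pow_pos (by linarith) _)).ne' heval

theorem eval_map_diagPoly_kernelPoly {n : ℕ} (ν : Finset (Fin n) → ℝ) {z : ℂ} (hz : z ≠ 0) :
    ((diagPoly (kernelPoly ν)).map (algebraMap ℝ ℂ)).eval z =
      z ^ n * ∑ B : Finset (Fin n), (ν B : ℂ) * (1 - 1 / z) ^ B.card := by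
  rw [diagPoly_kernelPoly, Polynomial.map_sum, eval_finsetSum, Finset.mul_sum]
  refine Finset.sum_congr rfl fun B _ => ?_
  have h := B.card_le_univ
  rw [Fintype.card_fin] at h
  have h1 : z - 1 = z * (1 - 1 / z) := by field_simp
  have hpow : z ^ n = z ^ B.card * z ^ (n - B.card) := by
    rw [← pow_add, Nat.add_sub_cancel' h]
  simp only [Polynomial.map_mul, Polynomial.map_C, Polynomial.map_pow, Polynomial.map_sub,
    Polynomial.map_X, Polynomial.map_one, Polynomial.eval_mul, Polynomial.eval_C,
    Polynomial.eval_pow, Polynomial.eval_sub, Polynomial.eval_X, Polynomial.eval_one,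
    h1, mul_pow, hpow, Complex.coe_algebraMap]
  ring

theorem StronglyRayleigh.condIn_add_condOut_ne_zero {n : ℕ} {μ : Finset (Fin (n + 1)) → ℝ}
    (hμ : StronglyRayleigh μ) (hp0 : probMem μ (Fin.last n) ≠ 0)
    (hp1 : 1 - probMem μ (Fin.last n) ≠ 0) {z t : ℂ} (hz : 0 < z.im) (ht : 0 < t.im) :
    t * (probMem μ (Fin.last n) *
      ((diagPoly (kernelPoly (condIn μ))).map (algebraMap ℝ ℂ)).eval z) +
    (1 - probMem μ (Fin.last n) : ℝ) *
      ((diagPoly (kernelPoly (condOut μ))).map (algebraMap ℝ ℂ)).eval z ≠ 0 := by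
  have hz0 : z ≠ 0 := by
    rintro rfl
    simp at hz
  have hy : 0 < (1 - 1 / z).im := by
    simp only [one_div, Complex.sub_im, Complex.one_im, Complex.inv_im, zero_sub, neg_div, neg_neg]
    exact div_pos hz (Complex.normSq_pos.mpr hz0)
  have hne := hμ.2 (Fin.snoc (fun _ => 1 - 1 / z) t) fun i => by
    refine Fin.lastCases ?_ (fun j => ?_) i
    · simpa using ht
    · simpa using hy
  rw [eval_genPoly, sum_finset_fin_succ] at hne
  have hprod : ∀ B : Finset (Fin n), ∏ i ∈ B.map Fin.castSuccEmb,
      (Fin.snoc (fun _ => 1 - 1 / z) t : Fin (n + 1) → ℂ) i = (1 - 1 / z) ^ B.card := by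
    intro B
    rw [Finset.prod_map]
    simp
  simp only [Finset.prod_insert (last_notMem_map _), hprod, Fin.snoc_last] at hne
  rw [eval_map_diagPoly_kernelPoly _ hz0, eval_map_diagPoly_kernelPoly _ hz0]
  have hin : ∀ B, μ (insert (Fin.last n) (B.map Fin.castSuccEmb)) =
      probMem μ (Fin.last n) * condIn μ B := fun B => (mul_div_cancel₀ _ hp0).symm
  have hout : ∀ B, μ (B.map Fin.castSuccEmb) =
      (1 - probMem μ (Fin.last n)) * condOut μ B := fun B => (mul_div_cancel₀ _ hp1).symm
  simp only [hin, hout, Complex.ofReal_mul] at hne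
  convert mul_ne_zero (pow_ne_zero n hz0) hne using 1
  rw [mul_add]
  refine congrArg₂ (· + ·) ?_ ?_
  · simp_rw [Finset.mul_sum]
    exact Finset.sum_congr rfl fun B _ => by ring
  · simp_rw [Finset.mul_sum]
    exact Finset.sum_congr rfl fun B _ => by ring

theorem stmt19 (n : ℕ) (μ : Finset (Fin (n + 1)) → ℝ) (hμ : StronglyRayleigh μ)
    (hp0 : 0 < probMem μ (Fin.last n)) (hp1 : probMem μ (Fin.last n) < 1) :
    ProperPosition (diagPoly (kernelPoly (condIn μ))) (diagPoly (kernelPoly μ)) ∧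
    ProperPosition (diagPoly (kernelPoly (condOut μ))) (diagPoly (kernelPoly μ)) := by
  have hq0 : 0 < 1 - probMem μ (Fin.last n) := sub_pos.mpr hp1
  have hu := isPointProcess_condIn hμ.1 hp0
  have hv := isPointProcess_condOut hμ.1 hp1
  have hg := diagPoly_kernelPoly_eq_condIn_add_condOut hp0.ne' hq0.ne'
  have hstable := fun z t : ℂ => hμ.condIn_add_condOut_ne_zero hp0.ne' hq0.ne' (z := z) (t := t)
  have hud := diagPoly_kernelPoly_natDegree_le (condIn μ)
  have hvd := diagPoly_kernelPoly_natDegree_le (condOut μ)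
  have huc := diagPoly_kernelPoly_coeff hu
  have hvc := diagPoly_kernelPoly_coeff hv
  have hur := fun x => diagPoly_kernelPoly_eval_root hu (x := x)
  have hvr := fun x => diagPoly_kernelPoly_eval_root hv (x := x)
  generalize diagPoly (kernelPoly (condIn μ)) = u at *
  generalize diagPoly (kernelPoly (condOut μ)) = v at *
  generalize probMem μ (Fin.last n) = p at *
  obtain ⟨hud', hul⟩ := natDegree_leadingCoeff_of_coeff_eq_one hud huc
  obtain ⟨hvd', hvl⟩ := natDegree_leadingCoeff_of_coeff_eq_one hvd hvc
  obtain ⟨had, hal⟩ := natDegree_leadingCoeff_of_coeff_eq_one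
    (p := Polynomial.C p * u + Polynomial.C (1 - p) * v) (n := n)
    (natDegree_add_le_of_degree_le ((natDegree_C_mul_le _ _).trans hud)
      ((natDegree_C_mul_le _ _).trans hvd)) (by simp [-map_sub, huc, hvc])
  have him : ∀ z : ℂ, 0 < z.im → 0 ≤ ((v.map (algebraMap ℝ ℂ)).eval z *
      conj ((u.map (algebraMap ℝ ℂ)).eval z)).im := by
    intro z hz
    have hs := hstable z
    generalize (v.map (algebraMap ℝ ℂ)).eval z = V at *
    generalize (u.map (algebraMap ℝ ℂ)).eval z = U at *
    by_contra! hneg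
    have hU : U ≠ 0 := by
      rintro rfl
      simp at hneg
    have hpC : (p : ℂ) ≠ 0 := by exact_mod_cast hp0.ne'
    refine hs (((-(1 - p) / (p * Complex.normSq U) : ℝ) : ℂ) * (V * conj U)) hz ?_ ?_
    · rw [Complex.im_ofReal_mul]
      refine mul_pos_of_neg_of_neg ?_ hneg
      exact div_neg_of_neg_of_pos (by linarith) (mul_pos hp0 (Complex.normSq_pos.mpr hU))
    · have hcU : conj U ≠ 0 := by simpa using hU
      push_cast
      rw [← Complex.mul_conj]
      field_simp
      ring
  have hnot : ∀ z : ℂ, 0 < z.im → (v.map (algebraMap ℝ ℂ)).eval z = 0 →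
      (u.map (algebraMap ℝ ℂ)).eval z ≠ 0 := by
    intro z hz h1 h2
    exact hstable z Complex.I hz (by simp) (by simp [h1, h2])
  have hu0 : u ≠ 0 := by
    rintro rfl
    simp at huc
  have hv0 : v ≠ 0 := by
    rintro rfl
    simp at hvc
  have hinj := (algebraMap ℝ ℂ).injective
  have huz : ∀ z : ℂ, 0 < z.im → (u.map (algebraMap ℝ ℂ)).eval z ≠ 0 := fun z hz =>
    eval_ne_zero_of_im_nonneg ((Polynomial.map_ne_zero_iff hinj).mpr hu0) him hnot hz
  have hvz : ∀ z : ℂ, 0 < z.im → (v.map (algebraMap ℝ ℂ)).eval z ≠ 0 := fun z hz =>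
    eval_ne_zero_of_im_nonneg (A := -u.map (algebraMap ℝ ℂ))
      ((Polynomial.map_ne_zero_iff hinj).mpr hv0)
      (fun w hw => by
        have := him w hw
        simp at this ⊢
        linarith)
      (fun w hw h1 h2 => hnot w hw h2 (by simpa using h1)) hz
  constructor
  · have := properPosition_of_im_nonneg (a := Polynomial.C p * u + Polynomial.C (1 - p) * v)
      (b := u) (e := 0) (s := 1) p (had.trans hud'.symm) (by rw [hal, hul]; norm_num)
      huz ?_ one_ne_zero (fun x hx => by simpa using (hur x hx).1)
    · convert this using 1
      rw [hg]
      simp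
      ring
    · intro z hz
      have := mul_nonneg hq0.le (him z hz)
      simp at this ⊢
      linarith
  · have := properPosition_of_im_nonneg (a := Polynomial.C p * u + Polynomial.C (1 - p) * v)
      (b := v) (e := 1) (s := -1) (-(1 - p)) (had.trans hvd'.symm) (by rw [hal, hvl]; norm_num)
      hvz ?_ (by norm_num) (fun x hx => by linarith [(hvr x hx).2])
    · convert this using 1
      rw [hg]
      simp
      ring
    · intro z hz
      have := mul_nonneg hp0.le (him z hz)
      simp at this ⊢
      linarith
end
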